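/- arXiv:2510.10848 — 4 statements merged into one kernel-verified Lean document; each statement's English description precedes it below -/
import Mathlib

section
/- Let Y be a nonempty irreducible (topologically transitive) sofic shift over a finite alphabet. Call a periodic point w ∈ Y receptive if there exist a finite alphabet B, an irreducible one-step SFT X over B, and a factor map π : X → Y (a continuous surjection with π∘σ_X = σ_Y∘π) such that w has a preimage under π with the same least period as w. Then the set of least periods of the receptive periodic points of Y is either a singleton {d} for some d ∈ ℕ, or equals dS for some positive integer d and some cofinite set S ⊆ ℕ. -/
/-- The shift map on the full shift `A^ℤ`: `(σ x) i = x (i+1)`. -/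
def shiftMap {A : Type*} : (ℤ → A) → (ℤ → A) := fun x i => x (i + 1)

/-- A one-step shift of finite type: the set of bi-infinite sequences all of whose
adjacent pairs lie in a relation `R ⊆ A × A`. -/
def IsOneStepSFT {A : Type*} (X : Set (ℤ → A)) : Prop :=
  ∃ R : Set (A × A), X = {x | ∀ i : ℤ, (x i, x (i + 1)) ∈ R}

/-- Topological transitivity of the shift restricted to a subset `X` of the full shift:
for all open `U, V` meeting `X` there is `n > 0` and a point of `X` in `U` whose
`n`-th shift lies in `V`. -/
def TransitiveOn {A : Type*} [TopologicalSpace A] (X : Set (ℤ → A)) : Prop :=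
  ∀ U V : Set (ℤ → A), IsOpen U → IsOpen V → (U ∩ X).Nonempty → (V ∩ X).Nonempty →
    ∃ n : ℕ, 0 < n ∧ ∃ x ∈ X, x ∈ U ∧ shiftMap^[n] x ∈ V

/-- A sofic shift: the image of a one-step SFT under a continuous shift-commuting map. -/
def IsSofic {A : Type*} [TopologicalSpace A] (Y : Set (ℤ → A)) : Prop :=
  ∃ (m : ℕ) (X : Set (ℤ → Fin m)) (π : (ℤ → Fin m) → (ℤ → A)),
    IsOneStepSFT X ∧ ContinuousOn π X ∧
      (∀ x ∈ X, π (shiftMap x) = shiftMap (π x)) ∧ π '' X = Y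

/-- `S` is a cofinite subset of `ℕ = {1, 2, 3, ...}`. -/
def CofinitePos (S : Set ℕ) : Prop :=
  S ⊆ {n : ℕ | 0 < n} ∧ ({n : ℕ | 0 < n} \ S).Finite

/-- The set of least periods of the receptive periodic points of a sofic shift `Y`:
those `n ≥ 1` for which some point `w ∈ Y` of least period `n` has, for some irreducible
one-step SFT `X` and factor map `π : X → Y`, a `π`-preimage of the same least period. -/
def receptiveLPS {A : Type*} [TopologicalSpace A] (Y : Set (ℤ → A)) : Set ℕ :=
  {n | 0 < n ∧ ∃ w ∈ Y, shiftMap^[n] w = w ∧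
    (∀ k, 0 < k → k < n → shiftMap^[k] w ≠ w) ∧
    ∃ (m : ℕ) (X : Set (ℤ → Fin m)) (π : (ℤ → Fin m) → (ℤ → A)),
      IsOneStepSFT X ∧ TransitiveOn X ∧ ContinuousOn π X ∧
      (∀ x ∈ X, π (shiftMap x) = shiftMap (π x)) ∧ π '' X = Y ∧
      ∃ x ∈ X, π x = w ∧ shiftMap^[n] x = x ∧
        ∀ k, 0 < k → k < n → shiftMap^[k] x ≠ x}

section Words

variable {A : Type*}

/-- The word of length `k` read in `y` from position `i` on. -/
def word (y : ℤ → A) (i : ℤ) (k : ℕ) : List A :=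
  (List.range k).map fun j : ℕ => y (i + j)

@[simp]
lemma length_word (y : ℤ → A) (i : ℤ) (k : ℕ) : (word y i k).length = k := by
  simp [word]

@[simp]
lemma word_zero (y : ℤ → A) (i : ℤ) : word y i 0 = [] := rfl

lemma word_one (y : ℤ → A) (i : ℤ) : word y i 1 = [y i] := by
  simp [word]

lemma word_add (y : ℤ → A) (i : ℤ) (k l : ℕ) :
    word y i (k + l) = word y i k ++ word y (i + k) l := by
  simp [word, List.range_add, add_assoc]

lemma word_eq_word_iff {y z : ℤ → A} {i j : ℤ} {k : ℕ} :
    word y i k = word z j k ↔ ∀ t : ℕ, t < k → y (i + t) = z (j + t) := by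
  simp [word]

lemma word_comp_add (y : ℤ → A) (i s : ℤ) (k : ℕ) :
    word (fun t => y (t + s)) i k = word y (i + s) k := by
  rw [word_eq_word_iff]
  intro t _
  congr 1
  ring

lemma word_append_iff {y : ℤ → A} {i : ℤ} {u v : List A} :
    word y i (u ++ v).length = u ++ v ↔
      word y i u.length = u ∧ word y (i + u.length) v.length = v := by
  rw [List.length_append, word_add]
  constructor
  · intro h
    exact List.append_inj h (by simp)
  · rintro ⟨h1, h2⟩
    rw [h1, h2]

/-- The language of a set of bi-infinite sequences. -/
def lang (Y : Set (ℤ → A)) : Set (List A) :=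
  {u | ∃ y ∈ Y, ∃ i, word y i u.length = u}

lemma word_mem_lang {Y : Set (ℤ → A)} {y : ℤ → A} (hy : y ∈ Y) (i : ℤ) (k : ℕ) :
    word y i k ∈ lang Y :=
  ⟨y, hy, i, by simp⟩

lemma lang_infix {Y : Set (ℤ → A)} {u v w : List A} (h : u ++ v ++ w ∈ lang Y) :
    v ∈ lang Y := by
  obtain ⟨y, hy, i, h⟩ := h
  rw [word_append_iff, word_append_iff] at h
  exact ⟨y, hy, _, h.1.2⟩

lemma lang_right {Y : Set (ℤ → A)} {u v : List A} (h : u ++ v ∈ lang Y) : v ∈ lang Y :=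
  lang_infix (u := u) (w := []) (by simpa using h)

lemma lang_left {Y : Set (ℤ → A)} {u v : List A} (h : u ++ v ∈ lang Y) : u ∈ lang Y :=
  lang_infix (u := []) (w := v) (by simpa using h)

/-- The follower set of the word `u` in the language `L`. -/
def follower (L : Set (List A)) (u : List A) : Set (List A) :=
  {v | u ++ v ∈ L}

/-- A set of sequences that is determined by an irreducible language with finitely many follower
sets, together with a synchronizing word `m`. -/
structure IsSynchronized (Y : Set (ℤ → A)) (m : List A) : Prop where
  mem_of_word_mem : ∀ y, (∀ i k, word y i k ∈ lang Y) → y ∈ Y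
  exists_bridge : ∀ u ∈ lang Y, ∀ v ∈ lang Y, ∃ w, u ++ w ++ v ∈ lang Y
  finite_follower : (Set.range (follower (lang Y))).Finite
  mem_lang : m ∈ lang Y
  sync : ∀ u v, u ++ m ∈ lang Y → m ++ v ∈ lang Y → u ++ m ++ v ∈ lang Y

/-- The `j`-th power of a word. -/
def wordPow (w : List A) (j : ℕ) : List A := (List.replicate j w).flatten

@[simp]
lemma wordPow_zero (w : List A) : wordPow w 0 = [] := rfl

lemma wordPow_succ (w : List A) (j : ℕ) : wordPow w (j + 1) = w ++ wordPow w j := by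
  simp [wordPow, List.replicate_succ]

@[simp]
lemma length_wordPow (w : List A) (j : ℕ) : (wordPow w j).length = j * w.length := by
  simp [wordPow]

/-- The sequence `y` is the periodic repetition of `w`, with a copy of `w` at the origin. -/
def IsRepetition (w : List A) (y : ℤ → A) : Prop :=
  (∀ i, y (i + w.length) = y i) ∧ word y 0 w.length = w

lemma add_mul_eq_of_period {y : ℤ → A} {p : ℤ} (h : ∀ i, y (i + p) = y i) (i k : ℤ) :
    y (i + k * p) = y i :=
  Function.Periodic.int_mul h k i

lemma word_add_mul_of_period {y : ℤ → A} {p : ℤ} (h : ∀ i, y (i + p) = y i) (i k : ℤ) (l : ℕ) :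
    word y (i + k * p) l = word y i l := by
  rw [word_eq_word_iff]
  intro t _
  rw [add_right_comm, add_mul_eq_of_period h]

lemma exists_isRepetition {w : List A} (hw : w ≠ []) : ∃ y, IsRepetition w y := by
  have hl : (0 : ℤ) < w.length := by exact_mod_cast List.length_pos_iff.2 hw
  have hb (i : ℤ) : (i % w.length).toNat < w.length := by
    have := Int.emod_lt_of_pos i hl
    have := Int.emod_nonneg i hl.ne'
    omega
  refine ⟨fun i => w[(i % w.length).toNat]'(hb i), fun i => by simp, ?_⟩
  apply List.ext_getElem (by simp)
  intro j h1 h2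
  simp only [word, zero_add, List.getElem_map, List.getElem_range]
  congr 1
  rw [Int.emod_eq_of_lt (by positivity) (by exact_mod_cast h2)]
  simp

lemma IsRepetition.ext {w : List A} (hw : w ≠ []) {y z : ℤ → A} (hy : IsRepetition w y)
    (hz : IsRepetition w z) : y = z := by
  have hl : (0 : ℤ) < w.length := by exact_mod_cast List.length_pos_iff.2 hw
  have h := word_eq_word_iff.1 (hy.2.trans hz.2.symm)
  funext i
  have h1 := Int.emod_lt_of_pos i hl
  have h2 := Int.emod_nonneg i hl.ne'
  have h3 : i = i % w.length + i / w.length * w.length := by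
    rw [mul_comm]; exact (Int.emod_add_mul_ediv i _).symm
  rw [h3, add_mul_eq_of_period hy.1, add_mul_eq_of_period hz.1]
  have := h (i % w.length).toNat (by omega)
  rwa [zero_add, Int.toNat_of_nonneg h2] at this

lemma IsRepetition.wordPow {w : List A} {y : ℤ → A} (hy : IsRepetition w y) (j : ℕ) :
    IsRepetition (wordPow w j) y := by
  refine ⟨fun i => ?_, ?_⟩
  · rw [length_wordPow]
    push_cast
    exact add_mul_eq_of_period hy.1 i j
  · induction j with
    | zero => simp
    | succ j ih =>
      rw [wordPow_succ, word_append_iff]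
      refine ⟨hy.2, ?_⟩
      have := word_add_mul_of_period hy.1 0 1 (_root_.wordPow w j).length
      rw [one_mul] at this
      rw [this, ih]

/-- The words leading from one occurrence of `m` to another one. -/
def returnWords (L : Set (List A)) (m : List A) : Set (List A) :=
  {w | w ++ m ∈ L ∧ m <+: w ++ m}

namespace IsSynchronized

variable {Y : Set (ℤ → A)} {m : List A}

lemma nil_mem_returnWords (h : IsSynchronized Y m) : [] ∈ returnWords (lang Y) m :=
  ⟨by simpa using h.mem_lang, by simp⟩

lemma append_mem_returnWords (h : IsSynchronized Y m) {u v : List A}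
    (hu : u ∈ returnWords (lang Y) m) (hv : v ∈ returnWords (lang Y) m) :
    u ++ v ∈ returnWords (lang Y) m := by
  obtain ⟨hv1, t, ht⟩ := hv
  have h1 : u ++ v ++ m = u ++ m ++ t := by rw [List.append_assoc, ← ht, List.append_assoc]
  refine ⟨?_, ?_⟩
  · rw [h1]
    exact h.sync u t hu.1 (ht ▸ hv1)
  · rw [h1]
    exact hu.2.trans (List.prefix_append _ _)

lemma wordPow_mem_returnWords (h : IsSynchronized Y m) {w : List A}
    (hw : w ∈ returnWords (lang Y) m) (j : ℕ) : wordPow w j ∈ returnWords (lang Y) m := by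
  induction j with
  | zero => exact h.nil_mem_returnWords
  | succ j ih => rw [wordPow_succ]; exact h.append_mem_returnWords hw ih

lemma mem_of_isRepetition (h : IsSynchronized Y m) {w : List A} (hne : w ≠ [])
    (hw : w ∈ returnWords (lang Y) m) {y : ℤ → A} (hy : IsRepetition w y) : y ∈ Y := by
  have hl : (0 : ℤ) < w.length := by exact_mod_cast List.length_pos_iff.2 hne
  apply h.mem_of_word_mem
  intro i k
  have h1 := Int.emod_nonneg i hl.ne'
  have h3 : i = i % w.length + i / w.length * w.length := by
    rw [mul_comm]; exact (Int.emod_add_mul_ediv i _).symm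
  rw [h3, word_add_mul_of_period hy.1]
  set r := (i % w.length).toNat with hr
  have hr' : i % w.length = 0 + r := by omega
  rw [hr']
  have h4 := lang_left (h.wordPow_mem_returnWords hw (r + k)).1
  rw [← (hy.wordPow (r + k)).2] at h4
  obtain ⟨s, hs⟩ : ∃ s, (wordPow w (r + k)).length = r + k + s := by
    apply Nat.exists_eq_add_of_le
    rw [length_wordPow]
    exact Nat.le_mul_of_pos_right _ (by omega)
  rw [hs, word_add, word_add] at h4
  exact lang_infix h4

/-- Every word of the language occurs in a return word. -/
lemma exists_returnWord (h : IsSynchronized Y m) {v : List A} (hv : v ∈ lang Y) :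
    ∃ a b, m ++ a ++ v ++ b ∈ returnWords (lang Y) m := by
  obtain ⟨a, ha⟩ := h.exists_bridge m h.mem_lang v hv
  obtain ⟨b, hb⟩ := h.exists_bridge _ ha m h.mem_lang
  exact ⟨a, b, hb, by simp⟩

end IsSynchronized

/-- The word `m` occurs in `y` arbitrarily far to the left. -/
def LeftRecurrent (m : List A) (y : ℤ → A) : Prop :=
  ∀ i : ℤ, ∃ j, j + m.length ≤ i ∧ word y j m.length = m

lemma IsRepetition.leftRecurrent {L : Set (List A)} {m w : List A} (hne : w ≠ [])
    (hw : w ∈ returnWords L m) {y : ℤ → A} (hy : IsRepetition w y) : LeftRecurrent m y := by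
  have hl : (0 : ℤ) < w.length := by exact_mod_cast List.length_pos_iff.2 hne
  have hpre (j : ℕ) : m <+: _root_.wordPow w j ++ m := by
    induction j with
    | zero => simp
    | succ j ih =>
      rw [wordPow_succ, List.append_assoc]
      exact hw.2.trans ((List.prefix_append_right_inj w).2 ih)
  have h0 : word y 0 m.length = m := by
    have h1 : m <+: _root_.wordPow w m.length :=
      List.prefix_of_prefix_length_le (hpre m.length) (List.prefix_append _ _) (by
        rw [length_wordPow]
        exact Nat.le_mul_of_pos_right _ (by omega))
    obtain ⟨t, ht⟩ := h1
    have h2 := (hy.wordPow m.length).2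
    rw [← ht] at h2
    exact (word_append_iff.1 h2).1
  intro i
  refine ⟨0 + (-(|i| + m.length)) * w.length, ?_, ?_⟩
  · have := neg_abs_le i
    nlinarith [abs_nonneg i]
  · rw [word_add_mul_of_period hy.1, h0]

end Words

section Cylinders

variable {A : Type*}

lemma iterate_shiftMap (n : ℕ) (x : ℤ → A) : shiftMap^[n] x = fun i => x (i + n) := by
  induction n with
  | zero => simp
  | succ n ih =>
    rw [Function.iterate_succ_apply', ih]
    funext i
    simp only [shiftMap]
    congr 1
    push_cast
    ring

lemma iterate_shiftMap_eq_self_iff {n : ℕ} {x : ℤ → A} :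
    shiftMap^[n] x = x ↔ ∀ i, x (i + n) = x i := by
  rw [iterate_shiftMap, funext_iff]

lemma exists_cylinder_subset [TopologicalSpace A] {U : Set (ℤ → A)} (hU : IsOpen U) {x : ℤ → A}
    (hx : x ∈ U) : ∃ N : ℕ, ∀ z, (∀ i : ℤ, |i| ≤ N → z i = x i) → z ∈ U := by
  obtain ⟨I, u, hu, hI⟩ := isOpen_pi_iff.1 hU x hx
  refine ⟨I.sup Int.natAbs, fun z hz => hI fun i hi => ?_⟩
  rw [hz i]
  · exact (hu i hi).2
  · have := Finset.le_sup (f := Int.natAbs) hi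
    rw [Int.abs_eq_natAbs]
    exact_mod_cast this

lemma isOpen_cylinder [TopologicalSpace A] [DiscreteTopology A] (x : ℤ → A) (N : ℕ) :
    IsOpen {z : ℤ → A | ∀ i : ℤ, |i| ≤ N → z i = x i} := by
  have : {z : ℤ → A | ∀ i : ℤ, |i| ≤ N → z i = x i} =
      ⋂ i ∈ Set.Icc (-(N : ℤ)) N, {z : ℤ → A | z i = x i} := by
    ext z
    simp [abs_le]
  rw [this]
  exact (Set.finite_Icc _ _).isOpen_biInter fun i _ =>
    (isOpen_discrete {x i}).preimage (f := fun z : ℤ → A => z i) (continuous_apply i)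

end Cylinders

section Fischer

variable {A : Type*} {Y : Set (ℤ → A)} {m : List A}

/-- The words that may follow the left-infinite past of `y` at position `i`. -/
def pastFollower (Y : Set (ℤ → A)) (y : ℤ → A) (i : ℤ) : Set (List A) :=
  {v | ∀ k : ℕ, word y (i - k) k ++ v ∈ lang Y}

lemma pastFollower_succ (y : ℤ → A) (i : ℤ) :
    pastFollower Y y (i + 1) = {v | y i :: v ∈ pastFollower Y y i} := by
  have key (k : ℕ) (v : List A) :
      word y (i + 1 - (k + 1 : ℕ)) (k + 1) ++ v = word y (i - k) k ++ y i :: v := by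
    rw [word_add, word_one]
    push_cast
    simp
  ext v
  constructor
  · intro hv k
    rw [← key]
    exact hv (k + 1)
  · rintro hv (_ | k)
    · exact lang_right (u := [y i]) (by simpa using hv 0)
    · rw [key]
      exact hv k

lemma IsSynchronized.pastFollower_eq (h : IsSynchronized Y m) {y : ℤ → A} (hy : y ∈ Y)
    {u : List A} {j : ℤ} (hu : word y j (m ++ u).length = m ++ u) :
    pastFollower Y y (j + (m ++ u).length) = follower (lang Y) (m ++ u) := by
  ext v
  constructor
  · intro hv
    have := hv (m ++ u).length
    rwa [add_sub_cancel_right, hu] at this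
  · intro hv k
    change m ++ u ++ v ∈ lang Y at hv
    rcases le_total k (m ++ u).length with hk | hk
    · obtain ⟨s, hs⟩ := Nat.exists_eq_add_of_le' hk
      rw [hs, word_add] at hu
      rw [← hu, List.append_assoc] at hv
      rw [hs]
      push_cast
      rw [← add_assoc, add_sub_cancel_right]
      exact lang_right hv
    · obtain ⟨s, hs⟩ := Nat.exists_eq_add_of_le' hk
      have h1 : j + (m ++ u).length - k = j - s := by rw [hs]; push_cast; ring
      rw [h1, hs, word_add, sub_add_cancel, hu]
      have h2 : word y (j - s) s ++ (m ++ u) ∈ lang Y := by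
        have := word_mem_lang hy (j - s) (s + (m ++ u).length)
        rwa [word_add, sub_add_cancel, hu] at this
      have := h.sync (word y (j - s) s) (u ++ v) (lang_left (v := u) (by simpa using h2))
        (by simpa using hv)
      simpa using this

/-- The states of the Fischer cover: the follower sets of words starting with `m`. -/
def FischerState (Y : Set (ℤ → A)) (m : List A) : Type _ :=
  {q : Set (List A) // ∃ u, m ++ u ∈ lang Y ∧ follower (lang Y) (m ++ u) = q}

lemma IsSynchronized.finite_fischerState (h : IsSynchronized Y m) : Finite (FischerState Y m) :=
  (h.finite_follower.subset (by rintro q ⟨u, -, rfl⟩; exact ⟨_, rfl⟩) :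
    {q : Set (List A) | ∃ u, m ++ u ∈ lang Y ∧ follower (lang Y) (m ++ u) = q}.Finite).to_subtype

lemma IsSynchronized.exists_pastFollower_eq (h : IsSynchronized Y m) {y : ℤ → A} (hy : y ∈ Y)
    (hm : LeftRecurrent m y) (i : ℤ) :
    ∃ u, m ++ u ∈ lang Y ∧ follower (lang Y) (m ++ u) = pastFollower Y y i := by
  obtain ⟨j, hj, hjm⟩ := hm i
  obtain ⟨t, ht⟩ := Int.eq_ofNat_of_zero_le (sub_nonneg.2 hj)
  have hu : word y j (m ++ word y (j + m.length) t).length = m ++ word y (j + m.length) t := by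
    rw [word_append_iff]
    exact ⟨hjm, by simp⟩
  refine ⟨word y (j + m.length) t, hu ▸ word_mem_lang hy _ _, ?_⟩
  rw [← h.pastFollower_eq hy hu]
  congr 1
  simp only [List.length_append, length_word]
  push_cast
  linarith

/-- The follower set component of a symbol of the Fischer cover. -/
def fischerState {n : ℕ} (e : FischerState Y m × A ≃ Fin n) (b : Fin n) : Set (List A) :=
  (e.symm b).1.1

/-- The labelling of the Fischer cover. -/
def fischerLabel {n : ℕ} (e : FischerState Y m × A ≃ Fin n) (x : ℤ → Fin n) : ℤ → A :=
  fun i => (e.symm (x i)).2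

/-- The Fischer cover: bi-infinite paths in the graph of follower sets. -/
def fischerShift {n : ℕ} (e : FischerState Y m × A ≃ Fin n) : Set (ℤ → Fin n) :=
  {x | ∀ i : ℤ, (x i, x (i + 1)) ∈
    {p : Fin n × Fin n | fischerState e p.2 = {v | (e.symm p.1).2 :: v ∈ fischerState e p.1}}}

variable {n : ℕ} {e : FischerState Y m × A ≃ Fin n}

lemma fischerState_add {x : ℤ → Fin n} (hx : x ∈ fischerShift e) (i : ℤ) (k : ℕ) :
    fischerState e (x (i + k)) =
      {v | word (fischerLabel e x) i k ++ v ∈ fischerState e (x i)} := by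
  induction k with
  | zero => simp
  | succ k ih =>
    have h1 := hx (i + k)
    simp only [Set.mem_ofPred_eq] at h1
    push_cast
    rw [← add_assoc, h1, ih]
    ext v
    simp [word_add, word_one, fischerLabel]

lemma word_mem_fischerState {x : ℤ → Fin n} (hx : x ∈ fischerShift e) (i : ℤ) (k : ℕ) :
    word (fischerLabel e x) i k ∈ fischerState e (x i) := by
  have h1 : [] ∈ fischerState e (x (i + k)) := by
    obtain ⟨u, hu, h⟩ := (e.symm (x (i + k))).1.2
    rw [fischerState, ← h]
    simpa [follower] using hu
  rw [fischerState_add hx] at h1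
  simpa using h1

lemma exists_word_append_mem_lang {x : ℤ → Fin n} (hx : x ∈ fischerShift e) (i : ℤ) (k : ℕ) :
    ∃ u, follower (lang Y) (m ++ u) = fischerState e (x i) ∧
      m ++ u ++ word (fischerLabel e x) i k ∈ lang Y := by
  have h1 := word_mem_fischerState hx i k
  obtain ⟨u, -, h⟩ := (e.symm (x i)).1.2
  refine ⟨u, h, ?_⟩
  rw [fischerState, ← h] at h1
  exact h1

lemma IsSynchronized.fischerLabel_mem (h : IsSynchronized Y m) {x : ℤ → Fin n}
    (hx : x ∈ fischerShift e) : fischerLabel e x ∈ Y := by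
  apply h.mem_of_word_mem
  intro i k
  obtain ⟨u, -, hu⟩ := exists_word_append_mem_lang hx i k
  exact lang_right hu

lemma fischerShift_deterministic {x z : ℤ → Fin n} (hx : x ∈ fischerShift e)
    (hz : z ∈ fischerShift e) {i j : ℤ} (hs : fischerState e (x i) = fischerState e (z j)) {k : ℕ}
    (hl : word (fischerLabel e x) i k = word (fischerLabel e z) j k) {t : ℕ} (ht : t < k) :
    x (i + t) = z (j + t) := by
  apply e.symm.injective
  rw [word_eq_word_iff] at hl
  refine Prod.ext (Subtype.ext ?_) (hl t ht)
  change fischerState e _ = fischerState e _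
  rw [fischerState_add hx, fischerState_add hz, hs,
    word_eq_word_iff.2 fun s hs => hl s (hs.trans ht)]

/-- A left recurrent point of `Y` lifts canonically to the Fischer cover. -/
lemma IsSynchronized.exists_lift (h : IsSynchronized Y m) (e : FischerState Y m × A ≃ Fin n)
    {y : ℤ → A} (hy : y ∈ Y) (hm : LeftRecurrent m y) :
    ∃ x ∈ fischerShift e, fischerLabel e x = y ∧
      ∀ i, fischerState e (x i) = pastFollower Y y i := by
  refine ⟨fun i => e (⟨pastFollower Y y i, h.exists_pastFollower_eq hy hm i⟩, y i), ?_, ?_, ?_⟩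
  · intro i
    simp [fischerState, pastFollower_succ]
  · funext i
    simp [fischerLabel]
  · intro i
    simp [fischerState]

lemma IsSynchronized.transitiveOn_fischerShift (h : IsSynchronized Y m) :
    TransitiveOn (fischerShift e) := by
  rintro U V hU hV ⟨x, hxU, hx⟩ ⟨x', hxV, hx'⟩
  obtain ⟨N₁, hN₁⟩ := exists_cylinder_subset hU hxU
  obtain ⟨N₂, hN₂⟩ := exists_cylinder_subset hV hxV
  set N := max N₁ N₂ with hN
  obtain ⟨u, hu, huL⟩ := exists_word_append_mem_lang hx (-N) (2 * N + 1)
  obtain ⟨u', hu', huL'⟩ := exists_word_append_mem_lang hx' (-N) (2 * N + 1)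
  obtain ⟨c, hc⟩ := h.exists_bridge _ huL _ huL'
  obtain ⟨a, b, hg⟩ := h.exists_returnWord hc
  have hne : m ++ a ++ (m ++ u ++ word (fischerLabel e x) (-N) (2 * N + 1) ++ c ++
      (m ++ u' ++ word (fischerLabel e x') (-N) (2 * N + 1))) ++ b ≠ [] := by
    rw [← List.length_pos_iff]
    simp
  obtain ⟨y, hy⟩ := exists_isRepetition hne
  have hyY := h.mem_of_isRepetition hne hg hy
  obtain ⟨x₀, hx₀, hlab, hst⟩ := h.exists_lift e hyY (hy.leftRecurrent hne hg)
  have hw := (word_append_iff.1 (word_append_iff.1 hy.2).1).2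
  have hw₁ := word_append_iff.1 (word_append_iff.1 (word_append_iff.1 hw).1).1
  have hw₂ := word_append_iff.1 (word_append_iff.1 hw).2
  have hs₁ := h.pastFollower_eq hyY hw₁.1
  have hs₂ := h.pastFollower_eq hyY hw₂.1
  rw [hu, ← hst] at hs₁
  rw [hu', ← hst] at hs₂
  generalize hp₁ : (0 + ((m ++ a).length : ℤ) + ((m ++ u).length : ℤ)) = p₁ at *
  generalize hp₂ : (0 + ((m ++ a).length : ℤ) + ((m ++ u ++ word (fischerLabel e x) (-N)
    (2 * N + 1) ++ c).length : ℤ) + ((m ++ u').length : ℤ)) = p₂ at *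
  have hlt : p₁ < p₂ := by
    simp at hp₁ hp₂
    omega
  have hz₁ := hw₁.2
  have hz₂ := hw₂.2
  rw [length_word, ← hlab] at hz₁ hz₂
  refine ⟨(p₂ - p₁).toNat, by omega, fun i => x₀ (i + (p₁ + N)), fun i => ?_, ?_, ?_⟩
  · have := hx₀ (i + (p₁ + N))
    rwa [add_right_comm] at this
  · apply hN₁
    intro i hi
    have := abs_le.1 hi
    have := fischerShift_deterministic hx₀ hx hs₁ hz₁ (t := (i + N).toNat) (by omega)
    convert this using 2 <;> omega
  · apply hN₂
    intro i hi
    have := abs_le.1 hi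
    have := fischerShift_deterministic hx₀ hx' hs₂ hz₂ (t := (i + N).toNat) (by omega)
    rw [iterate_shiftMap]
    convert this using 2 <;> omega

lemma continuous_fischerLabel [TopologicalSpace A] : Continuous (fischerLabel e) :=
  continuous_pi fun i =>
    (continuous_of_discreteTopology (f := fun b : Fin n => (e.symm b).2)).comp (continuous_apply i)

lemma isClosed_of_isOneStepSFT {B : Type*} [TopologicalSpace B] [DiscreteTopology B]
    {X : Set (ℤ → B)} (hX : IsOneStepSFT X) : IsClosed X := by
  obtain ⟨R, rfl⟩ := hX
  rw [Set.ofPred_forall]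
  exact isClosed_iInter fun i => (isClosed_discrete R).preimage
    (f := fun x : ℤ → B => (x i, x (i + 1))) (by fun_prop)

lemma isOneStepSFT_fischerShift (e : FischerState Y m × A ≃ Fin n) :
    IsOneStepSFT (fischerShift e) := ⟨_, rfl⟩

lemma IsSynchronized.image_fischerShift [TopologicalSpace A] [DiscreteTopology A]
    (h : IsSynchronized Y m) : fischerLabel e '' fischerShift e = Y := by
  apply Set.Subset.antisymm
  · rintro _ ⟨x, hx, rfl⟩
    exact h.fischerLabel_mem hx
  · intro y hy
    have hcl : IsClosed (fischerLabel e '' fischerShift e) :=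
      ((isClosed_of_isOneStepSFT (isOneStepSFT_fischerShift e)).isCompact.image
        continuous_fischerLabel).isClosed
    rw [← hcl.closure_eq, mem_closure_iff]
    intro U hU hyU
    obtain ⟨N, hN⟩ := exists_cylinder_subset hU hyU
    obtain ⟨a, b, hg⟩ := h.exists_returnWord (word_mem_lang hy (-N) (2 * N + 1))
    have hne : m ++ a ++ word y (-N) (2 * N + 1) ++ b ≠ [] := by
      rw [← List.length_pos_iff]
      simp
    obtain ⟨z, hz⟩ := exists_isRepetition hne
    obtain ⟨x, hx, hlab, -⟩ :=
      h.exists_lift e (h.mem_of_isRepetition hne hg hz) (hz.leftRecurrent hne hg)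
    have hw := (word_append_iff.1 (word_append_iff.1 hz.2).1).2
    rw [length_word, word_eq_word_iff] at hw
    generalize (0 + ((m ++ a).length : ℤ)) = p at *
    refine ⟨fun i => z (i + (p + N)), hN _ fun i hi => ?_, fun i => x (i + (p + N)), fun i => ?_, ?_⟩
    · have := abs_le.1 hi
      have := hw (i + N).toNat (by omega)
      convert this using 2 <;> omega
    · have := hx (i + (p + N))
      rwa [add_right_comm] at this
    · rw [← hlab]
      rfl

/-- A periodic point in which the synchronizing word occurs is receptive. -/
lemma IsSynchronized.mem_receptiveLPS [Finite A] [TopologicalSpace A] [DiscreteTopology A]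
    (h : IsSynchronized Y m) {y : ℤ → A} (hy : y ∈ Y) (hm : LeftRecurrent m y) {p : ℕ} (hp : 0 < p)
    (hper : shiftMap^[p] y = y) (hleast : ∀ k, 0 < k → k < p → shiftMap^[k] y ≠ y) :
    p ∈ receptiveLPS Y := by
  have := h.finite_fischerState
  obtain ⟨n, ⟨e⟩⟩ := Finite.exists_equiv_fin (FischerState Y m × A)
  obtain ⟨x, hx, rfl, hst⟩ := h.exists_lift e hy hm
  refine ⟨hp, _, hy, hper, hleast, n, fischerShift e, fischerLabel e, isOneStepSFT_fischerShift e,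
    h.transitiveOn_fischerShift, continuous_fischerLabel.continuousOn, fun _ _ => rfl,
    h.image_fischerShift, x, hx, rfl, ?_, fun k hk hkp hkx => hleast k hk hkp ?_⟩
  · rw [iterate_shiftMap_eq_self_iff] at hper ⊢
    intro i
    apply e.symm.injective
    refine Prod.ext (Subtype.ext ?_) (hper i)
    change fischerState e _ = fischerState e _
    rw [hst, hst]
    ext v
    refine forall_congr' fun k => ?_
    have := word_add_mul_of_period hper (i - k) 1 k
    rw [one_mul, sub_add_eq_add_sub] at this
    rw [this]
  · rw [iterate_shiftMap_eq_self_iff] at hkx ⊢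
    intro i
    simp only [fischerLabel, hkx i]

end Fischer

section Transitivity

variable {A : Type*} [TopologicalSpace A] {X : Set (ℤ → A)}

lemma TransitiveOn.exists_ge (hX : TransitiveOn X) {U V : Set (ℤ → A)} (hU : IsOpen U)
    (hV : IsOpen V) (hUX : (U ∩ X).Nonempty) (hVX : (V ∩ X).Nonempty) (K : ℕ) :
    ∃ n ≥ K, ∃ x ∈ X, x ∈ U ∧ shiftMap^[n] x ∈ V := by
  induction K with
  | zero =>
    obtain ⟨n, -, h⟩ := hX U V hU hV hUX hVX
    exact ⟨n, n.zero_le, h⟩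
  | succ K ih =>
    obtain ⟨n, hn, x, hx, hxU, hxV⟩ := ih
    have hcont : Continuous (shiftMap^[n] : (ℤ → A) → ℤ → A) := by
      have : (shiftMap^[n] : (ℤ → A) → ℤ → A) = fun x i => x (i + n) :=
        funext (iterate_shiftMap n)
      rw [this]
      fun_prop
    obtain ⟨k, hk, z, hz, hzU, hzV⟩ := hX U (U ∩ shiftMap^[n] ⁻¹' V) hU
      (hU.inter (hV.preimage hcont)) hUX ⟨x, ⟨hxU, hxV⟩, hx⟩
    refine ⟨n + k, by omega, z, hz, hzU, ?_⟩
    rw [Function.iterate_add_apply]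
    exact hzV.2

lemma TransitiveOn.exists_agree [DiscreteTopology A] (hX : TransitiveOn X) {x y : ℤ → A}
    (hx : x ∈ X) (hy : y ∈ X) (r K : ℕ) :
    ∃ n ≥ K, ∃ z ∈ X, (∀ j : ℤ, |j| ≤ r → z j = x j) ∧ ∀ j : ℤ, |j| ≤ r → z (j + n) = y j := by
  obtain ⟨n, hn, z, hz, h1, h2⟩ := hX.exists_ge (isOpen_cylinder x r) (isOpen_cylinder y r)
    ⟨x, fun _ _ => rfl, hx⟩ ⟨y, fun _ _ => rfl, hy⟩ K
  refine ⟨n, hn, z, hz, h1, fun j hj => ?_⟩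
  have := h2 j hj
  rwa [iterate_shiftMap] at this

end Transitivity

/-- A sliding block map of radius `N` from a set `X` of sequences that may be spliced along common
symbols onto a set `Y` of sequences. -/
structure IsBlockFactor {A B : Type*} (X : Set (ℤ → B)) (π : (ℤ → B) → ℤ → A) (Y : Set (ℤ → A))
    (N : ℕ) : Prop where
  splice_mem : ∀ x ∈ X, ∀ y ∈ X, ∀ p : ℤ, x p = y p → (fun i => if i ≤ p then x i else y i) ∈ X
  shift_mem : ∀ x ∈ X, ∀ k : ℤ, (fun i => x (i + k)) ∈ X
  map_shift : ∀ x ∈ X, ∀ k i : ℤ, π (fun i => x (i + k)) i = π x (i + k)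
  map_congr : ∀ x ∈ X, ∀ y ∈ X, ∀ i : ℤ, (∀ j, |j - i| ≤ N → x j = y j) → π x i = π y i
  image_eq : π '' X = Y

section SFT

variable {A B : Type*} {X : Set (ℤ → B)} {π : (ℤ → B) → ℤ → A} {Y : Set (ℤ → A)}

lemma IsOneStepSFT.shift_mem (hX : IsOneStepSFT X) {x : ℤ → B} (hx : x ∈ X) (k : ℤ) :
    (fun i => x (i + k)) ∈ X := by
  obtain ⟨R, rfl⟩ := hX
  intro i
  have := hx (i + k)
  rwa [add_right_comm] at this

lemma IsOneStepSFT.splice_mem (hX : IsOneStepSFT X) {x y : ℤ → B} (hx : x ∈ X) (hy : y ∈ X)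
    {p : ℤ} (hp : x p = y p) : (fun i => if i ≤ p then x i else y i) ∈ X := by
  obtain ⟨R, rfl⟩ := hX
  intro i
  rcases lt_trichotomy i p with h | rfl | h
  · simpa [h.le, Int.add_one_le_iff.2 h] using hx i
  · simpa [hp] using hy i
  · simpa [h.not_ge, (h.trans (lt_add_one i)).not_ge] using hy i

lemma IsOneStepSFT.map_shift (hX : IsOneStepSFT X)
    (hπ : ∀ x ∈ X, π (shiftMap x) = shiftMap (π x)) {x : ℤ → B} (hx : x ∈ X) (k : ℤ) :
    ∀ i, π (fun i => x (i + k)) i = π x (i + k) := by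
  induction k using Int.induction_on with
  | zero => simp
  | succ k ih =>
    intro i
    have h1 := congrFun (hπ _ (hX.shift_mem hx k)) i
    have h2 : shiftMap (fun i => x (i + k)) = fun i => x (i + (k + 1)) := by
      funext i
      simp only [shiftMap]
      congr 1
      ring
    rw [h2] at h1
    rw [h1, shiftMap, ih]
    congr 1
    ring
  | pred k ih =>
    intro i
    have h1 := congrFun (hπ _ (hX.shift_mem hx (-k - 1))) (i - 1)
    have h2 : shiftMap (fun i => x (i + (-k - 1))) = fun i => x (i + -k) := by
      funext i
      simp only [shiftMap]
      congr 1
      ring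
    rw [h2, ih, shiftMap, sub_add_cancel] at h1
    rw [← h1]
    congr 1
    ring

variable [TopologicalSpace A] [DiscreteTopology A] [TopologicalSpace B] [DiscreteTopology B]

lemma exists_radius_of_continuousOn (hX : IsCompact X) (hπ : ContinuousOn π X) :
    ∃ N : ℕ, ∀ x ∈ X, ∀ y ∈ X, (∀ j : ℤ, |j| ≤ N → x j = y j) → π x 0 = π y 0 := by
  have hloc (x : ℤ → B) (hx : x ∈ X) :
      ∃ N : ℕ, ∀ z ∈ X, (∀ j : ℤ, |j| ≤ N → z j = x j) → π z 0 = π x 0 := by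
    have h1 : ContinuousOn (fun x => π x 0) X := (continuous_apply 0).comp_continuousOn hπ
    obtain ⟨U, hU, hUX⟩ := (continuousOn_iff'.1 h1) {π x 0} (isOpen_discrete _)
    have hxU : x ∈ U := ((Set.ext_iff.1 hUX x).1 ⟨rfl, hx⟩).1
    obtain ⟨N, hN⟩ := exists_cylinder_subset hU hxU
    exact ⟨N, fun z hz hzx => ((Set.ext_iff.1 hUX z).2 ⟨hN z hzx, hz⟩).1⟩
  choose! N hN using hloc
  obtain ⟨t, ht, hcov⟩ := hX.elim_nhds_subcover
    (fun x => {z : ℤ → B | ∀ i : ℤ, |i| ≤ N x → z i = x i})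
    fun x _ => (isOpen_cylinder x (N x)).mem_nhds fun _ _ => rfl
  refine ⟨t.sup N, fun x hx y hy hxy => ?_⟩
  obtain ⟨c, hc, hxc⟩ := Set.mem_iUnion₂.1 (hcov hx)
  have hle : N c ≤ t.sup N := Finset.le_sup hc
  rw [hN c (ht c hc) x hx hxc, hN c (ht c hc) y hy fun j hj => ?_]
  rw [← hxc j hj, hxy j (hj.trans (by exact_mod_cast hle))]

lemma exists_isBlockFactor [Finite B] (hX : IsOneStepSFT X) (hcont : ContinuousOn π X)
    (hπ : ∀ x ∈ X, π (shiftMap x) = shiftMap (π x)) (him : π '' X = Y) :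
    ∃ N, IsBlockFactor X π Y N := by
  obtain ⟨N, hN⟩ := exists_radius_of_continuousOn (isClosed_of_isOneStepSFT hX).isCompact hcont
  refine ⟨N, fun x hx y hy p => hX.splice_mem hx hy, fun x hx => hX.shift_mem hx,
    fun x hx => hX.map_shift hπ hx, fun x hx y hy i hxy => ?_, him⟩
  rw [← zero_add i, ← hX.map_shift hπ hx, ← hX.map_shift hπ hy]
  refine hN _ (hX.shift_mem hx i) _ (hX.shift_mem hy i) fun j hj => hxy _ ?_
  rwa [add_sub_cancel_right]

end SFT

namespace IsBlockFactor

variable {A B : Type*} {X : Set (ℤ → B)} {π : (ℤ → B) → ℤ → A} {Y : Set (ℤ → A)} {N : ℕ}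

lemma shift_mem_image (h : IsBlockFactor X π Y N) {y : ℤ → A} (hy : y ∈ Y) (k : ℤ) :
    (fun i => y (i + k)) ∈ Y := by
  rw [← h.image_eq] at hy ⊢
  obtain ⟨x, hx, rfl⟩ := hy
  exact ⟨_, h.shift_mem x hx k, funext (h.map_shift x hx k)⟩

lemma exists_word_eq (h : IsBlockFactor X π Y N) {u : List A} (hu : u ∈ lang Y) (i : ℤ) :
    ∃ x ∈ X, word (π x) i u.length = u := by
  obtain ⟨y, hy, j, hj⟩ := hu
  have := h.shift_mem_image hy (j - i)
  rw [← h.image_eq] at this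
  obtain ⟨x, hx, hxy⟩ := this
  refine ⟨x, hx, ?_⟩
  rw [hxy, word_comp_add, add_sub_cancel, hj]

lemma map_mem (h : IsBlockFactor X π Y N) {x : ℤ → B} (hx : x ∈ X) : π x ∈ Y :=
  h.image_eq ▸ ⟨x, hx, rfl⟩

lemma word_map_congr (h : IsBlockFactor X π Y N) {x y : ℤ → B} (hx : x ∈ X) (hy : y ∈ X) {i : ℤ}
    {k : ℕ} (hxy : ∀ j, i - N ≤ j → j < i + k + N → x j = y j) :
    word (π x) i k = word (π y) i k := by
  rw [word_eq_word_iff]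
  intro t ht
  refine h.map_congr x hx y hy _ fun j hj => hxy j ?_ ?_ <;>
  · have := abs_le.1 hj
    omega

lemma follower_eq (h : IsBlockFactor X π Y N) (u : List A) :
    follower (lang Y) u = {v | ∃ x ∈ X, word (π x) 0 v.length = v ∧
      (fun j : Fin (2 * N + 1) => x (-N + (j : ℕ))) ∈ {f : Fin (2 * N + 1) → B | ∃ x ∈ X,
        word (π x) (-u.length) u.length = u ∧ ∀ j : Fin (2 * N + 1), x (-N + (j : ℕ)) = f j}} := by
  ext v
  constructor
  · intro hv
    obtain ⟨x, hx, hxw⟩ := h.exists_word_eq hv (-u.length)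
    rw [word_append_iff, neg_add_cancel] at hxw
    exact ⟨x, hx, hxw.2, x, hx, hxw.1, fun _ => rfl⟩
  · rintro ⟨x, hx, hv, z, hz, hu, hzx⟩
    have hag (j : ℤ) (hj : -N ≤ j) (hj' : j ≤ N) : z j = x j := by
      have := hzx ⟨(j + N).toNat, by omega⟩
      convert this using 2 <;> simp only <;> omega
    have hs := h.splice_mem z hz x hx 0 (hag 0 (by omega) (by omega))
    refine ⟨_, h.map_mem hs, -u.length, ?_⟩
    rw [word_append_iff, neg_add_cancel]
    constructor
    · rw [← hu, length_word]
      apply h.word_map_congr hs hz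
      intro j _ hj
      split_ifs with hj0
      · rfl
      · exact (hag j (by omega) (by omega)).symm
    · rw [← hv, length_word]
      apply h.word_map_congr hs hx
      intro j hj _
      split_ifs with hj0
      · exact hag j (by omega) (by omega)
      · rfl

lemma finite_follower [Finite B] (h : IsBlockFactor X π Y N) :
    (Set.range (follower (lang Y))).Finite := by
  refine (Set.finite_range fun E : Set (Fin (2 * N + 1) → B) => {v : List A | ∃ x ∈ X,
    word (π x) 0 v.length = v ∧ (fun j : Fin (2 * N + 1) => x (-N + (j : ℕ))) ∈ E}).subset ?_
  rintro _ ⟨u, rfl⟩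
  exact ⟨_, (h.follower_eq u).symm⟩

lemma exists_bridge [TopologicalSpace A] [DiscreteTopology A] (h : IsBlockFactor X π Y N)
    (hirr : TransitiveOn Y) {u v : List A} (hu : u ∈ lang Y) (hv : v ∈ lang Y) :
    ∃ w, u ++ w ++ v ∈ lang Y := by
  obtain ⟨x, hx, hxu⟩ := h.exists_word_eq hu 0
  obtain ⟨x', hx', hxv⟩ := h.exists_word_eq hv 0
  obtain ⟨n, hn, z, hz, h1, h2⟩ :=
    hirr.exists_agree (h.map_mem hx) (h.map_mem hx') (u.length + v.length) u.length
  obtain ⟨s, hs⟩ := Nat.exists_eq_add_of_le hn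
  refine ⟨word z u.length s, z, hz, 0, ?_⟩
  rw [word_append_iff, word_append_iff]
  refine ⟨⟨?_, by simp⟩, ?_⟩
  · nth_rw 2 [← hxu]
    rw [word_eq_word_iff]
    intro t ht
    apply h1
    rw [abs_le]
    omega
  · nth_rw 2 [← hxv]
    rw [word_eq_word_iff]
    intro t ht
    rw [← h2 _ (by rw [abs_le]; omega)]
    congr 1
    simp only [List.length_append, length_word]
    omega

lemma mem_of_word_mem_lang [TopologicalSpace A] (h : IsBlockFactor X π Y N) (hY : IsClosed Y)
    {y : ℤ → A} (hy : ∀ i k, word y i k ∈ lang Y) : y ∈ Y := by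
  rw [← hY.closure_eq, mem_closure_iff]
  intro U hU hyU
  obtain ⟨r, hr⟩ := exists_cylinder_subset hU hyU
  obtain ⟨x, hx, hxw⟩ := h.exists_word_eq (hy (-r) (2 * r + 1)) (-r)
  rw [length_word, word_eq_word_iff] at hxw
  refine ⟨π x, hr _ fun i hi => ?_, h.map_mem hx⟩
  have := abs_le.1 hi
  have := hxw (i + r).toNat (by omega)
  convert this using 2 <;> omega

/-- An irreducible sofic shift has a synchronizing word: any word with minimal follower set. -/
lemma exists_isSynchronized [Finite B] [TopologicalSpace A] [DiscreteTopology A]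
    (h : IsBlockFactor X π Y N) (hY : IsClosed Y) (hne : Y.Nonempty) (hirr : TransitiveOn Y) :
    ∃ m, IsSynchronized Y m := by
  obtain ⟨y, hy⟩ := hne
  obtain ⟨m, hm, hmin⟩ := Set.Finite.exists_minimalFor' (follower (lang Y)) (lang Y)
    (h.finite_follower.subset (Set.image_subset_range _ _)) ⟨[], word_mem_lang hy 0 0⟩
  refine ⟨m, fun y => h.mem_of_word_mem_lang hY, fun u hu v hv => h.exists_bridge hirr hu hv,
    h.finite_follower, hm, fun u v hu hv => ?_⟩
  refine hmin hu (fun w hw => ?_) hv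
  change u ++ m ++ w ∈ lang Y at hw
  rw [List.append_assoc] at hw
  exact lang_right hw

lemma exists_returnWord_length (h : IsBlockFactor X π Y N) {m : List A} {t s : ℤ → B} (ht : t ∈ X)
    (hs : s ∈ X) {p : ℤ} (hts : t p = s p) (hp : N + m.length ≤ p)
    (htm : word (π t) 0 m.length = m) {k : ℕ} (hk : p + N ≤ k)
    (hsm : word (π s) k m.length = m) : ∃ w ∈ returnWords (lang Y) m, w.length = k := by
  have hz := h.splice_mem t ht s hs p hts
  set z : ℤ → B := fun i => if i ≤ p then t i else s i with hzdef
  have h0 : word (π z) 0 m.length = m := by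
    rw [← htm, length_word]
    apply h.word_map_congr hz ht
    intro j _ hj
    simp only [hzdef]
    rw [if_pos (by omega)]
  have h1 : word (π z) k m.length = m := by
    rw [← hsm, length_word]
    apply h.word_map_congr hz hs
    intro j hj _
    simp only [hzdef]
    split_ifs with hj'
    · rw [show j = p by omega, hts]
    · rfl
  have h2 : word (π z) 0 k ++ m = word (π z) 0 (k + m.length) := by
    rw [word_add, zero_add, h1]
  refine ⟨word (π z) 0 k, ⟨?_, ?_⟩, by simp⟩
  · rw [h2]
    exact word_mem_lang (h.map_mem hz) _ _
  · rw [h2, add_comm, word_add, h0]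
    exact List.prefix_append _ _

/-- If an irreducible shift of finite type with a factor map onto `Y` has a point of period `n`,
then `n` is a difference of lengths of return words. -/
lemma exists_returnWord_length_add [TopologicalSpace B] [DiscreteTopology B]
    (h : IsBlockFactor X π Y N) (hX : TransitiveOn X) {m : List A} (hm : m ∈ lang Y) {x : ℤ → B}
    (hx : x ∈ X) {n : ℕ} (hper : ∀ i, x (i + n) = x i) :
    ∃ w ∈ returnWords (lang Y) m, ∃ w' ∈ returnWords (lang Y) m, w'.length = w.length + n := by
  obtain ⟨s₀, hs₀, hs₀m⟩ := h.exists_word_eq hm 0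
  obtain ⟨n₁, hn₁, s, hs, hsx, hss⟩ := hX.exists_agree hx hs₀ (N + m.length) N
  obtain ⟨n₂, hn₂, t, ht, htt, htx⟩ := hX.exists_agree hs₀ hx (N + m.length) (N + m.length)
  have hsm : word (π s) n₁ m.length = m := by
    have h1 := h.word_map_congr (h.shift_mem s hs n₁) hs₀ (i := 0) (k := m.length) (fun j hj hj' =>
      hss j (abs_le.2 (by omega)))
    rwa [hs₀m, funext (h.map_shift s hs n₁), word_comp_add, zero_add] at h1
  have htm : word (π t) 0 m.length = m := by
    rw [h.word_map_congr ht hs₀ fun j hj hj' => htt j (abs_le.2 (by omega)), hs₀m]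
  have hs0 : s 0 = x 0 := hsx 0 (by simp; omega)
  have ht0 : t n₂ = x 0 := by simpa using htx 0 (by simp; omega)
  have hshift (q : ℤ) : word (π fun i => s (i + -q)) (n₁ + q) m.length = m := by
    rw [funext (h.map_shift s hs (-q)), word_comp_add, add_neg_cancel_right, hsm]
  obtain ⟨w, hw, hwl⟩ := h.exists_returnWord_length ht (h.shift_mem s hs (-n₂)) (p := n₂)
    (by simp [hs0, ht0]) (by omega) htm (k := n₁ + n₂) (by omega) (by
      push_cast; exact hshift n₂)
  have htx' : t n₂ = x (n₂ + -n₂) := by simp [ht0]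
  have ht' := h.splice_mem t ht _ (h.shift_mem x hx (-n₂)) n₂ htx'
  obtain ⟨w', hw', hwl'⟩ := h.exists_returnWord_length ht' (h.shift_mem s hs (-(n₂ + n : ℕ)))
    (p := (n₂ + n : ℕ)) (m := m) (by
      have h1 : x (n₂ + n + -n₂) = x 0 := by
        rw [← hper 0]
        congr 1
        ring
      push_cast
      split_ifs with hn
      · have : n = 0 := by omega
        simp [this, hs0, ht0]
      · rw [h1]
        simp [hs0]) (by omega) (by
      rw [h.word_map_congr ht' ht, htm]
      intro j hj hj'
      rw [if_pos (by omega)]) (k := n₁ + n₂ + n) (by omega) (by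
      have := hshift (n₂ + n : ℕ)
      rwa [show (n₁ : ℤ) + (n₂ + n : ℕ) = (n₁ + n₂ + n : ℕ) by push_cast; ring] at this)
  exact ⟨w, hw, w', hw', by omega⟩

end IsBlockFactor

namespace IsSynchronized

variable {A : Type*} {Y : Set (ℤ → A)} {m : List A}

lemma exists_returnWord_ne_nil (h : IsSynchronized Y m) :
    ∃ w ∈ returnWords (lang Y) m, w ≠ [] := by
  obtain ⟨y, hy, -⟩ := h.mem_lang
  obtain ⟨a, b, hab⟩ := h.exists_returnWord (word_mem_lang hy 0 1)
  exact ⟨_, hab, by simp [word_one]⟩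

/-- The lengths of return words have a common divisor `d`, all of whose large multiples occur. -/
lemma exists_gcd_length (h : IsSynchronized Y m) :
    ∃ d, 0 < d ∧ (∀ w ∈ returnWords (lang Y) m, d ∣ w.length) ∧
      ∃ K, ∀ n ≥ K, d ∣ n → ∃ w ∈ returnWords (lang Y) m, w.length = n := by
  let G : AddSubmonoid ℕ :=
    { carrier := List.length '' returnWords (lang Y) m
      add_mem' := by
        rintro _ _ ⟨u, hu, rfl⟩ ⟨v, hv, rfl⟩
        exact ⟨u ++ v, h.append_mem_returnWords hu hv, List.length_append⟩
      zero_mem' := ⟨[], h.nil_mem_returnWords, rfl⟩ }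
  refine ⟨Nat.setGcd (G : Set ℕ), ?_, fun w hw => Nat.setGcd_dvd_of_mem ⟨w, hw, rfl⟩, ?_⟩
  · obtain ⟨w, hw, hne⟩ := h.exists_returnWord_ne_nil
    rw [Nat.pos_iff_ne_zero, Ne, Nat.setGcd_eq_zero_iff]
    intro h0
    exact hne (List.length_eq_zero_iff.1 (h0 ⟨w, hw, rfl⟩))
  · obtain ⟨K, hK⟩ := Nat.exists_mem_closure_of_ge (G : Set ℕ)
    refine ⟨K, fun n hn hd => ?_⟩
    have := hK n hn hd
    rwa [AddSubmonoid.closure_eq] at this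

/-- If return words of the same length agree, then every point of `Y` has period `d`. -/
lemma apply_add_eq_of_unique (h : IsSynchronized Y m)
    (huniq : ∀ a ∈ returnWords (lang Y) m, ∀ b ∈ returnWords (lang Y) m,
      a.length = b.length → a = b) {d K : ℕ}
    (hK : ∀ n ≥ K, d ∣ n → ∃ w ∈ returnWords (lang Y) m, w.length = n) (hd : 0 < d) {y : ℤ → A}
    (hy : y ∈ Y) (i : ℤ) : y (i + d) = y i := by
  obtain ⟨a, b, hab⟩ := h.exists_returnWord (word_mem_lang hy i (d + 1))
  set w := m ++ a ++ word y i (d + 1) ++ b with hw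
  have hne : w ≠ [] := by
    rw [← List.length_pos_iff]
    simp [hw]
  obtain ⟨z, hz⟩ := exists_isRepetition hne
  have hper (c : List A) (hc : c ∈ returnWords (lang Y) m) (hcl : 0 < c.length) (i : ℤ) :
      z (i + c.length) = z i := by
    have hcne : c ≠ [] := List.length_pos_iff.1 hcl
    obtain ⟨x, hx⟩ := exists_isRepetition hcne
    have heq : wordPow w c.length = wordPow c w.length :=
      huniq _ (h.wordPow_mem_returnWords hab _) _ (h.wordPow_mem_returnWords hc _) (by
        simp [mul_comm])
    have hpos : wordPow w c.length ≠ [] := by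
      rw [← List.length_pos_iff, length_wordPow]
      exact Nat.mul_pos hcl (List.length_pos_iff.2 hne)
    have hzx : z = x := (hz.wordPow c.length).ext hpos (heq ▸ hx.wordPow w.length)
    rw [hzx]
    exact hx.1 i
  obtain ⟨c₁, hc₁, hl₁⟩ := hK (d * (K + 1)) (by nlinarith) (Dvd.intro _ rfl)
  obtain ⟨c₂, hc₂, hl₂⟩ := hK (d * (K + 2)) (by nlinarith) (Dvd.intro _ rfl)
  have hzd (i : ℤ) : z (i + d) = z i := by
    have h1 := hper c₁ hc₁ (by rw [hl₁]; positivity) (i + d)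
    have h2 := hper c₂ hc₂ (by rw [hl₂]; positivity) i
    rw [← h1, ← h2, hl₁, hl₂]
    congr 1
    push_cast
    ring
  have hv := (word_append_iff.1 (word_append_iff.1 hz.2).1).2
  rw [length_word, word_eq_word_iff] at hv
  have h0 := hv 0 (by omega)
  have h1 := hv d (by omega)
  rw [← h1, hzd]
  simpa using h0

/-- If two distinct return words have the same length, then all large multiples of `d` are least
periods of receptive points. -/
lemma exists_le_mem_receptiveLPS [Finite A] [TopologicalSpace A] [DiscreteTopology A]
    (h : IsSynchronized Y m) {a b : List A} (ha : a ∈ returnWords (lang Y) m)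
    (hb : b ∈ returnWords (lang Y) m) (hlen : a.length = b.length) (hab : a ≠ b) {d K : ℕ}
    (hd : ∀ w ∈ returnWords (lang Y) m, d ∣ w.length)
    (hK : ∀ n ≥ K, d ∣ n → ∃ w ∈ returnWords (lang Y) m, w.length = n) :
    ∃ K', ∀ n ≥ K', d ∣ n → n ∈ receptiveLPS Y := by
  have hane : a ≠ [] := by
    rintro rfl
    exact hab (List.length_eq_zero_iff.1 hlen.symm).symm
  have hl : 0 < a.length := List.length_pos_iff.2 hane
  refine ⟨2 * K + 6 * a.length, fun n hn hdn => ?_⟩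
  have hdiv := Nat.mod_add_div (n - K) a.length
  have hmod := Nat.mod_lt (n - K) hl
  set r := (n - K) % a.length
  set q := (n - K) / a.length
  obtain ⟨c, hc, hcl⟩ := hK (K + r) (by omega) (by
    rw [show n = K + r + a.length * q by omega] at hdn
    exact (Nat.dvd_add_left ((hd a ha).mul_right q)).1 hdn)
  obtain ⟨s, hs⟩ : ∃ s, q = s + 1 := Nat.exists_eq_succ_of_ne_zero (by
    intro hq
    rw [hq] at hdiv
    omega)
  rw [hs, mul_add, mul_one, mul_comm] at hdiv
  have hw := h.append_mem_returnWords
    (h.append_mem_returnWords (h.wordPow_mem_returnWords ha s) hb) hc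
  set w := wordPow a s ++ b ++ c with hwdef
  have hwl : w.length = n := by
    simp only [hwdef, List.length_append, length_wordPow]
    omega
  have hwne : w ≠ [] := by
    rw [← List.length_pos_iff]
    omega
  obtain ⟨y, hy⟩ := exists_isRepetition hwne
  have hper : shiftMap^[n] y = y := iterate_shiftMap_eq_self_iff.2 (hwl ▸ hy.1)
  refine h.mem_receptiveLPS (h.mem_of_isRepetition hwne hw hy) (hy.leftRecurrent hwne hw)
    (by omega) hper fun k hk hkn hky => hab ?_
  have hgcd : Function.IsPeriodicPt shiftMap (k.gcd n) y := Function.IsPeriodicPt.gcd hky hper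
  have hper' := iterate_shiftMap_eq_self_iff.1 hgcd
  have hle := Nat.le_of_dvd hk (Nat.gcd_dvd_left k n)
  have hpos := Nat.gcd_pos_of_pos_left n hk
  obtain ⟨j, hj⟩ := Nat.gcd_dvd_right k n
  set t := k.gcd n
  have hj2 : 2 ≤ j := by
    by_contra! hj'
    interval_cases j <;> omega
  have ht : t * 2 ≤ n := hj ▸ Nat.mul_le_mul_left t hj2
  obtain ⟨hys, hyb⟩ := word_append_iff.1 (word_append_iff.1 hy.2).1
  obtain ⟨z, hz⟩ := exists_isRepetition hane
  have hyz := word_eq_word_iff.1 (hys.trans (hz.wordPow s).2.symm)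
  rw [length_wordPow] at hyz
  have hya (i : ℤ) : y (i + a.length) = y i := by
    have h1 := Int.emod_nonneg i (b := t) (by omega)
    have h2 := Int.emod_lt_of_pos i (b := t) (by omega)
    have h3 : i = i % t + i / t * t := by
      rw [mul_comm]; exact (Int.emod_add_mul_ediv i _).symm
    have h4 := hyz (i % t).toNat (by omega)
    have h5 := hyz ((i % t).toNat + a.length) (by omega)
    push_cast at h4 h5
    rw [Int.toNat_of_nonneg h1, zero_add] at h4 h5
    rw [h3, add_right_comm, add_mul_eq_of_period hper', add_mul_eq_of_period hper', h4, h5, hz.1]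
  rw [← hyb, ← hlen, length_wordPow]
  push_cast
  rw [word_add_mul_of_period hya]
  nth_rw 1 [← hz.2]
  rw [eq_comm, word_eq_word_iff]
  intro t ht
  exact hyz t (by omega)

/-- A synchronized system in which all points have period `d`, where `d` divides all receptive
least periods, has `d` as its only receptive least period. -/
lemma receptiveLPS_eq_singleton [Finite A] [TopologicalSpace A] [DiscreteTopology A]
    (h : IsSynchronized Y m) {d : ℕ} (hpos : 0 < d) (hd : ∀ n ∈ receptiveLPS Y, d ∣ n)
    (hper : ∀ y ∈ Y, ∀ i, y (i + d) = y i) : receptiveLPS Y = {d} := by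
  have hle (n : ℕ) (hn : n ∈ receptiveLPS Y) : n = d := by
    refine (Nat.le_of_not_lt fun hlt => ?_).antisymm (Nat.le_of_dvd hn.1 (hd n hn))
    obtain ⟨-, w, hw, -, hleast, -⟩ := hn
    exact hleast d hpos hlt (iterate_shiftMap_eq_self_iff.2 (hper w hw))
  obtain ⟨w, hw, hne⟩ := h.exists_returnWord_ne_nil
  obtain ⟨y, hy⟩ := exists_isRepetition hne
  have hyY := h.mem_of_isRepetition hne hw hy
  have hp : Function.IsPeriodicPt shiftMap d y := iterate_shiftMap_eq_self_iff.2 (hper y hyY)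
  have hmem : Function.minimalPeriod shiftMap y ∈ receptiveLPS Y :=
    h.mem_receptiveLPS hyY (hy.leftRecurrent hne hw) (hp.minimalPeriod_pos hpos)
      Function.iterate_minimalPeriod fun k hk hlt =>
        Function.not_isPeriodicPt_of_pos_of_lt_minimalPeriod hk.ne' hlt
  exact Set.eq_singleton_iff_unique_mem.2 ⟨hle _ hmem ▸ hmem, hle⟩

end IsSynchronized

/-- For a nonempty irreducible sofic shift, the set of least periods of the receptive
periodic points is either a singleton `{d}` or of the form `dS` with `S` cofinite. -/
theorem receptive_LPS_of_irreducible_sofic {A : Type*} [Fintype A] [TopologicalSpace A]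
    [DiscreteTopology A] (Y : Set (ℤ → A)) (hne : Y.Nonempty) (hsofic : IsSofic Y)
    (hirr : TransitiveOn Y) :
    (∃ d : ℕ, receptiveLPS Y = {d}) ∨
    (∃ (d : ℕ) (S : Set ℕ), 0 < d ∧ CofinitePos S ∧
      receptiveLPS Y = (fun s => d * s) '' S) := by
  obtain ⟨n, X, π, hX, hcont, hπ, him⟩ := hsofic
  obtain ⟨N, hN⟩ := exists_isBlockFactor hX hcont hπ him
  have hcl : IsClosed Y :=
    him ▸ ((isClosed_of_isOneStepSFT hX).isCompact.image_of_continuousOn hcont).isClosed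
  obtain ⟨m, hm⟩ := hN.exists_isSynchronized hcl hne hirr
  obtain ⟨d, hpos, hd, K, hK⟩ := hm.exists_gcd_length
  have hdvd : ∀ n ∈ receptiveLPS Y, d ∣ n := by
    rintro n ⟨-, _, -, -, -, _, X', π', hX', htrans, hcont', hπ', him', x, hx, -, hper, -⟩
    obtain ⟨N', hN'⟩ := exists_isBlockFactor hX' hcont' hπ' him'
    obtain ⟨w, hw, w', hw', hlen⟩ := hN'.exists_returnWord_length_add htrans hm.mem_lang hx
      (iterate_shiftMap_eq_self_iff.1 hper)
    exact (Nat.dvd_add_right (hd w hw)).1 (hlen ▸ hd w' hw')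
  by_cases huniq : ∀ a ∈ returnWords (lang Y) m, ∀ b ∈ returnWords (lang Y) m,
      a.length = b.length → a = b
  · exact Or.inl ⟨d, hm.receptiveLPS_eq_singleton hpos hdvd fun y hy i =>
      hm.apply_add_eq_of_unique huniq hK hpos hy i⟩
  · push Not at huniq
    obtain ⟨a, ha, b, hb, hlen, hab⟩ := huniq
    obtain ⟨K', hK'⟩ := hm.exists_le_mem_receptiveLPS ha hb hlen hab hd hK
    refine Or.inr ⟨d, {s | d * s ∈ receptiveLPS Y}, hpos, ⟨fun s hs => ?_, ?_⟩, ?_⟩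
    · exact Nat.pos_of_mul_pos_left hs.1
    · refine (Set.finite_lt_nat K').subset fun s hs => ?_
      by_contra hsK
      exact hs.2 (hK' _ ((not_lt.1 hsK).trans (Nat.le_mul_of_pos_left s hpos)) (Dvd.intro _ rfl))
    · ext n
      constructor
      · intro hn
        obtain ⟨s, rfl⟩ := hdvd n hn
        exact ⟨s, hn, rfl⟩
      · rintro ⟨s, hs, rfl⟩
        exact hs
end

section
/- Let S ⊆ ℕ contain at least two distinct elements, and let d be the greatest common divisor of the elements of S (i.e., d divides every element of S, and every common divisor of S divides d). Then there exists a cofinite set S' ⊆ ℕ such that the almost sum-closure satisfies Σ*_S = d·S' = {d·s : s ∈ S'}. -/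
/-- The almost sum-closure `Σ*_T`: all sums of finitely many elements of `T` which are
either a single element or use at least two distinct elements. -/
def almostSumClosure (T : Set ℕ) : Set ℕ :=
  {m | ∃ (k : ℕ) (n : Fin k → ℕ), 0 < k ∧ (∀ i, n i ∈ T) ∧
    (k = 1 ∨ ∃ i j, n i ≠ n j) ∧ m = ∑ i, n i}

theorem sum_mem_almostSumClosure {T : Set ℕ} {a b : ℕ} {l : List ℕ} (ha : a ∈ T) (hb : b ∈ T)
    (hab : a ≠ b) (hl : ∀ x ∈ l, x ∈ T) : a + b + l.sum ∈ almostSumClosure T := by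
  refine ⟨(a :: b :: l).length, (a :: b :: l).get, by simp, fun i => ?_,
    Or.inr ⟨⟨0, by simp⟩, ⟨1, by simp⟩, by simpa using hab⟩, ?_⟩
  · have h : ∀ x ∈ a :: b :: l, x ∈ T := by simpa [ha, hb] using hl
    exact h _ (List.get_mem _ _)
  · simp only [List.get_eq_getElem, Fin.sum_univ_getElem, List.sum_cons, add_assoc]

theorem exists_forall_ge_mem_almostSumClosure {T : Set ℕ} (h : T.Nontrivial) :
    ∃ N, ∀ m ≥ N, Nat.setGcd T ∣ m → m ∈ almostSumClosure T := by
  obtain ⟨a, ha, b, hb, hab⟩ := h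
  obtain ⟨N, hN⟩ := Nat.exists_mem_closure_of_ge T
  refine ⟨N + (a + b), fun m hm hdvd => ?_⟩
  have hsub : Nat.setGcd T ∣ m - (a + b) :=
    Nat.dvd_sub hdvd (dvd_add (Nat.setGcd_dvd_of_mem ha) (Nat.setGcd_dvd_of_mem hb))
  obtain ⟨l, hl, hsum⟩ :=
    AddSubmonoid.exists_list_of_mem_closure (hN (m - (a + b)) (by omega) hsub)
  have hm' : m = a + b + l.sum := by omega
  exact hm' ▸ sum_mem_almostSumClosure ha hb hab hl

/-- If `S ⊆ ℕ = {1, 2, ...}` has at least two distinct elements and `d = gcd S`, then the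
almost sum-closure `Σ*_S` equals `d·S'` for some cofinite set `S'`. -/
theorem almostSumClosure_eq_gcd_mul_cofinite (S : Set ℕ) (hpos : ∀ m ∈ S, 0 < m)
    (htwo : ∃ a ∈ S, ∃ b ∈ S, a ≠ b) (d : ℕ)
    (hdvd : ∀ m ∈ S, d ∣ m) (hgcd : ∀ e : ℕ, (∀ m ∈ S, e ∣ m) → e ∣ d) :
    ∃ S' : Set ℕ, CofinitePos S' ∧
      almostSumClosure S = (fun s => d * s) '' S' := by
  obtain ⟨N, hN⟩ := exists_forall_ge_mem_almostSumClosure (T := S) htwo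
  have hd : 0 < d := by
    obtain ⟨a, ha, -⟩ := htwo
    exact Nat.pos_of_dvd_of_pos (hdvd a ha) (hpos a ha)
  refine ⟨{s | 0 < s ∧ d * s ∈ almostSumClosure S}, ⟨fun s hs => hs.1, ?_⟩, ?_⟩
  · refine (Set.finite_lt_nat N).subset ?_
    rintro s ⟨hs, hns⟩
    by_contra hlt
    have hle : N ≤ d * s := (not_lt.mp hlt).trans (Nat.le_mul_of_pos_left s hd)
    exact hns ⟨hs, hN _ hle
      ((hgcd _ fun m hm => Nat.setGcd_dvd_of_mem hm).trans (dvd_mul_right d s))⟩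
  · ext m
    constructor
    · intro hm
      obtain ⟨k, n, hk, hn, -, hsum⟩ := id hm
      obtain ⟨s, rfl⟩ : d ∣ m := hsum ▸ Finset.dvd_sum fun i _ => hdvd _ (hn i)
      have hms : 0 < d * s :=
        hsum ▸ Finset.sum_pos (fun i _ => hpos _ (hn i)) ⟨⟨0, hk⟩, Finset.mem_univ _⟩
      exact ⟨s, ⟨Nat.pos_of_mul_pos_left hms, hm⟩, rfl⟩
    · rintro ⟨s, hs, rfl⟩
      exact hs.2
end

section
/- Let S ⊆ ℕ be either a singleton, or of the form F ∪ ⋃_{i=1}^n d_i S_i where F ⊆ ℕ is finite, n ≥ 1, d_1, ..., d_n are positive integers, and S_1, ..., S_n ⊆ ℕ are cofinite (so at least one nonempty cofinite S_i appears). Then there exists an irreducible (topologically transitive) sofic shift Y ⊆ {0,1}^ℤ with LPS(Y) = S. -/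
/-- The least period set of the shift restricted to a subset `X` of the full shift. -/
def LPSset {A : Type*} (X : Set (ℤ → A)) : Set ℕ :=
  {n | 0 < n ∧ ∃ x ∈ X, shiftMap^[n] x = x ∧ ∀ k, 0 < k → k < n → shiftMap^[k] x ≠ x}

lemma shiftMap_iterate_apply {A : Type*} (n : ℕ) (x : ℤ → A) (i : ℤ) :
    shiftMap^[n] x i = x (i + n) := by
  induction n generalizing x with
  | zero => simp
  | succ n ih =>
    rw [Function.iterate_succ_apply, ih]
    simp only [shiftMap]
    congr 1
    push_cast
    ring

lemma shiftMap_iterate_eq_iff {A : Type*} (n : ℕ) (x : ℤ → A) :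
    shiftMap^[n] x = x ↔ ∀ i : ℤ, x (i + n) = x i := by
  simp only [funext_iff, shiftMap_iterate_apply]

lemma mem_LPSset_iff {A : Type*} {X : Set (ℤ → A)} {n : ℕ} :
    n ∈ LPSset X ↔ 0 < n ∧ ∃ x ∈ X, (∀ i : ℤ, x (i + n) = x i) ∧
      ∀ k : ℕ, 0 < k → k < n → ¬ ∀ i : ℤ, x (i + k) = x i := by
  simp only [LPSset, Set.mem_ofPred_eq, ne_eq, shiftMap_iterate_eq_iff]

lemma LPSset_mono {A : Type*} {X Y : Set (ℤ → A)} (h : X ⊆ Y) : LPSset X ⊆ LPSset Y :=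
  fun _ ⟨hn, x, hx, hp⟩ => ⟨hn, x, h hx, hp⟩

lemma LPSset_union {A : Type*} (X Y : Set (ℤ → A)) :
    LPSset (X ∪ Y) = LPSset X ∪ LPSset Y := by
  refine Set.Subset.antisymm ?_
    (Set.union_subset (LPSset_mono Set.subset_union_left) (LPSset_mono Set.subset_union_right))
  rintro n ⟨hn, x, hx | hx, hp⟩
  · exact Or.inl ⟨hn, x, hx, hp⟩
  · exact Or.inr ⟨hn, x, hx, hp⟩

/-- The label sequences of bi-infinite paths in the graph `R` with vertex labels `l`. -/
def labelShift {V : Type*} (R : V → V → Prop) (l : V → Fin 2) : Set (ℤ → Fin 2) :=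
  {y | ∃ x : ℤ → V, (∀ i, R (x i) (x (i + 1))) ∧ y = fun i => l (x i)}

lemma isSofic_labelShift {V : Type*} [Finite V] (R : V → V → Prop) (l : V → Fin 2) :
    IsSofic (labelShift R l) := by
  obtain ⟨m, ⟨e⟩⟩ := Finite.exists_equiv_fin V
  refine ⟨m, {z | ∀ i : ℤ, (z i, z (i + 1)) ∈ {p : Fin m × Fin m | R (e.symm p.1) (e.symm p.2)}},
    fun z i => l (e.symm (z i)), ⟨_, rfl⟩, ?_, fun _ _ => rfl, ?_⟩
  · refine Continuous.continuousOn (continuous_pi fun i => ?_)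
    exact (continuous_of_discreteTopology (f := fun k => l (e.symm k))).comp (continuous_apply i)
  · ext y
    constructor
    · rintro ⟨z, hz, rfl⟩
      exact ⟨fun i => e.symm (z i), hz, rfl⟩
    · rintro ⟨x, hx, rfl⟩
      exact ⟨fun i => e (x i), by simpa using hx, by simp⟩

lemma exists_window {A : Type*} [TopologicalSpace A] [DiscreteTopology A] {U : Set (ℤ → A)}
    (hU : IsOpen U) {x : ℤ → A} (hx : x ∈ U) :
    ∃ N : ℕ, ∀ y : ℤ → A, (∀ i : ℤ, -N ≤ i → i ≤ N → y i = x i) → y ∈ U := by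
  obtain ⟨I, u, hu, hIU⟩ := isOpen_pi_iff.1 hU x hx
  refine ⟨I.sup Int.natAbs, fun y hy => hIU fun i hi => ?_⟩
  have h : i.natAbs ≤ I.sup Int.natAbs := Finset.le_sup (f := Int.natAbs) hi
  rw [hy i (by omega) (by omega)]
  exact (hu i hi).2

lemma exists_path_of_reflTransGen {V : Type*} {R : V → V → Prop} {u v : V}
    (h : Relation.ReflTransGen R u v) :
    ∃ (p : ℕ) (w : ℕ → V), w 0 = u ∧ w p = v ∧ ∀ t < p, R (w t) (w (t + 1)) := by
  induction h with
  | refl => exact ⟨0, fun _ => u, rfl, rfl, by simp⟩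
  | @tail b c _ hbc ih =>
    obtain ⟨p, w, h0, hp, hw⟩ := ih
    refine ⟨p + 1, fun t => if t ≤ p then w t else c, by simpa using h0, by simp, ?_⟩
    intro t ht
    rcases Nat.lt_or_ge t p with h | h
    · simpa [h.le, Nat.succ_le_of_lt h] using hw t h
    · obtain rfl : t = p := by omega
      simpa [hp] using hbc

lemma transitiveOn_labelShift {V : Type*} (R : V → V → Prop) (l : V → Fin 2)
    (hR : ∀ u v, Relation.ReflTransGen R u v) : TransitiveOn (labelShift R l) := by
  rintro U W hU hW ⟨_, hxU, x, hx, rfl⟩ ⟨_, hyW, y, hy, rfl⟩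
  obtain ⟨N₁, h₁⟩ := exists_window hU hxU
  obtain ⟨N₂, h₂⟩ := exists_window hW hyW
  obtain ⟨N, hN⟩ : ∃ N, N = N₁ + N₂ + 1 := ⟨_, rfl⟩
  obtain ⟨p, w, hw0, hwp, hw⟩ := exists_path_of_reflTransGen (hR (x N) (y (-N)))
  let z : ℤ → V := fun i =>
    if i ≤ N then x i else if i ≤ N + p then w (i - N).toNat else y (i - (2 * N + p : ℕ))
  have hz₁ : ∀ i : ℤ, i ≤ N → z i = x i := fun i hi => if_pos hi
  have hz₂ : ∀ t : ℕ, t ≤ p → z (N + t) = w t := by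
    intro t ht
    rcases Nat.eq_zero_or_pos t with rfl | h
    · simp [z, hw0]
    · simp only [z]
      rw [if_neg (by omega), if_pos (by omega)]
      congr 1
      omega
  have hz₃ : ∀ i : ℤ, -N ≤ i → z (i + (2 * N + p : ℕ)) = y i := by
    intro i hi
    rcases eq_or_lt_of_le hi with rfl | h
    · rw [← hwp, ← hz₂ p le_rfl]
      congr 1
      push_cast
      ring
    · simp only [z]
      rw [if_neg (by push_cast; omega), if_neg (by push_cast; omega)]
      simp
  have hz : ∀ i, R (z i) (z (i + 1)) := by
    intro i
    rcases lt_or_ge i N with h | h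
    · rw [hz₁ i h.le, hz₁ _ (by omega)]
      exact hx i
    · rcases lt_or_ge i (N + p) with h' | h'
      · obtain ⟨t, rfl⟩ : ∃ t : ℕ, i = N + t := ⟨(i - N).toNat, by omega⟩
        have := hw t (by omega)
        rwa [← hz₂ t (by omega), ← hz₂ (t + 1) (by omega), Nat.cast_succ, ← add_assoc] at this
      · obtain ⟨j, rfl⟩ : ∃ j : ℤ, i = j + (2 * N + p : ℕ) := ⟨i - (2 * N + p : ℕ), by ring⟩
        have := hy j
        rw [← hz₃ j (by omega), ← hz₃ (j + 1) (by omega)] at this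
        convert this using 2
        ring
  refine ⟨2 * N + p, by omega, fun i => l (z i), ⟨z, hz, rfl⟩, h₁ _ ?_, h₂ _ ?_⟩
  · intro i _ hi
    rw [hz₁ i (by omega)]
  · intro i hi _
    rw [shiftMap_iterate_apply]
    rw [hz₃ i (by omega)]

/-- Periods realized by a finite labelled graph in which every vertex has a successor and a
predecessor and no two adjacent vertices are both labelled `1`. -/
def SparselyRealizable (S : Set ℕ) : Prop :=
  ∃ (V : Type) (_ : Finite V) (R : V → V → Prop) (l : V → Fin 2),
    (∀ v, ∃ w, R v w) ∧ (∀ w, ∃ v, R v w) ∧ (∀ v w, R v w → ¬ (l v = 1 ∧ l w = 1)) ∧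
      LPSset (labelShift R l) = S

lemma sparselyRealizable_empty : SparselyRealizable ∅ := by
  refine ⟨Empty, inferInstance, fun _ _ => True, fun _ => 0, fun v => v.elim, fun v => v.elim,
    fun v => v.elim, ?_⟩
  ext n
  simp only [Set.mem_empty_iff_false, iff_false]
  rintro ⟨_, _, ⟨x, _⟩, _⟩
  exact (x 0).elim

lemma forall_int_of_iff_succ {p : ℤ → Prop} (h : ∀ i, p i ↔ p (i + 1)) {i₀ : ℤ} (h₀ : p i₀)
    (i : ℤ) : p i := by
  induction i using Int.inductionOn' (b := i₀) with
  | zero => exact h₀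
  | succ k _ ih => exact (h k).1 ih
  | pred k _ ih => exact (h (k - 1)).2 (by simpa using ih)

lemma labelShift_sum {V W : Type*} (R : V → V → Prop) (R' : W → W → Prop) (l : V → Fin 2)
    (l' : W → Fin 2) :
    labelShift (Sum.LiftRel R R') (Sum.elim l l') = labelShift R l ∪ labelShift R' l' := by
  ext y
  constructor
  · rintro ⟨x, hx, rfl⟩
    have hstep : ∀ i, (x i).isLeft ↔ (x (i + 1)).isLeft := by
      intro i
      have := hx i
      cases h : x i <;> cases h' : x (i + 1) <;> simp_all
    rcases h0 : x 0 with v | w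
    · have hl := forall_int_of_iff_succ hstep (i₀ := 0) (by simp [h0])
      choose v hv using fun i => Sum.isLeft_iff.1 (hl i)
      exact Or.inl ⟨v, fun i => by simpa [hv] using hx i, by simp [hv]⟩
    · have hl := forall_int_of_iff_succ (fun i => not_congr (hstep i)) (i₀ := 0) (by simp [h0])
      choose w hw using fun i => Sum.isRight_iff.1 (by simpa using hl i)
      exact Or.inr ⟨w, fun i => by simpa [hw] using hx i, by simp [hw]⟩
  · rintro (⟨x, hx, rfl⟩ | ⟨x, hx, rfl⟩)
    · exact ⟨fun i => .inl (x i), fun i => .inl (hx i), rfl⟩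
    · exact ⟨fun i => .inr (x i), fun i => .inr (hx i), rfl⟩

lemma SparselyRealizable.union {S T : Set ℕ} (hS : SparselyRealizable S)
    (hT : SparselyRealizable T) : SparselyRealizable (S ∪ T) := by
  obtain ⟨V, _, R, l, hs, hp, h11, rfl⟩ := hS
  obtain ⟨W, _, R', l', hs', hp', h11', rfl⟩ := hT
  refine ⟨V ⊕ W, inferInstance, Sum.LiftRel R R', Sum.elim l l', ?_, ?_, ?_, ?_⟩
  · rintro (v | w)
    · exact (hs v).imp' Sum.inl fun _ => .inl
    · exact (hs' w).imp' Sum.inr fun _ => .inr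
  · rintro (v | w)
    · exact (hp v).imp' Sum.inl fun _ => .inl
    · exact (hp' w).imp' Sum.inr fun _ => .inr
  · rintro _ _ (h | h)
    · exact h11 _ _ h
    · exact h11' _ _ h
  · rw [labelShift_sum, LPSset_union]

/-- The label on the cycle `ZMod m` that marks the vertex `1`, unless it is the only vertex. -/
def cycleLabel (m : ℕ) (a : ZMod m) : Fin 2 := if a = 1 ∧ a ≠ 0 then 1 else 0

lemma LPSset_cycle {m : ℕ} (hm : 0 < m) :
    LPSset (labelShift (fun a b : ZMod m => b = a + 1) (cycleLabel m)) = {m} := by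
  have key : ∀ x : ℤ → ZMod m, (∀ i, x (i + 1) = x i + 1) → ∀ i : ℤ, x i = x 0 + i := by
    intro x hx
    refine forall_int_of_iff_succ (fun i => ?_) (i₀ := 0) (by simp)
    rw [hx, Int.cast_add, Int.cast_one, ← add_assoc]
    exact (add_left_inj 1).symm
  have hper : ∀ x : ℤ → ZMod m, (∀ i, x (i + 1) = x i + 1) → ∀ n : ℕ,
      (∀ i : ℤ, cycleLabel m (x (i + n)) = cycleLabel m (x i)) → m ∣ n := by
    intro x hx n hn
    rw [← ZMod.natCast_eq_zero_iff]
    by_cases h1 : (1 : ZMod m) = 0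
    · rw [← mul_one (n : ZMod m), h1, mul_zero]
    · obtain ⟨i, hi⟩ := ZMod.intCast_surjective (1 - x 0)
      have hi1 : x i = 1 := by rw [key x hx, hi]; ring
      have h := hn i
      have h' : x (i + n) = 1 + n := by
        rw [key x hx, Int.cast_add, hi, Int.cast_natCast]; ring
      rw [hi1, h'] at h
      by_contra hne
      simp [cycleLabel, h1, hne] at h
  ext n
  rw [mem_LPSset_iff, Set.mem_singleton_iff]
  constructor
  · rintro ⟨hn, _, ⟨x, hx, rfl⟩, hpn, hmin⟩
    by_contra hne
    have hmn := Nat.le_of_dvd hn (hper x hx n hpn)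
    refine hmin m hm (by omega) fun i => ?_
    simp only
    rw [key x hx, key x hx i]
    simp
  · rintro rfl
    refine ⟨hm, _, ⟨fun i => (i : ZMod n), by simp, rfl⟩, by simp, fun k hk hkm h => ?_⟩
    have := Nat.le_of_dvd hk (hper (fun i => (i : ZMod n)) (by simp) k h)
    omega

lemma sparselyRealizable_singleton {m : ℕ} (hm : 0 < m) : SparselyRealizable {m} := by
  have : NeZero m := ⟨hm.ne'⟩
  refine ⟨ZMod m, inferInstance, fun a b => b = a + 1, cycleLabel m, fun a => ⟨a + 1, rfl⟩,
    fun a => ⟨a - 1, by ring⟩, ?_, LPSset_cycle hm⟩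
  rintro a _ rfl ⟨ha, hb⟩
  simp only [cycleLabel, ne_eq, ite_eq_left_iff, not_and, not_not] at ha hb
  grind

lemma sparselyRealizable_finite {S : Set ℕ} (hS : S.Finite) (hpos : ∀ m ∈ S, 0 < m) :
    SparselyRealizable S := by
  induction S, hS using Set.Finite.induction_on with
  | empty => exact sparselyRealizable_empty
  | @insert a S _ _ ih =>
    rw [Set.insert_eq]
    exact (sparselyRealizable_singleton (hpos a (by simp))).union
      (ih fun m hm => hpos m (by simp [hm]))

lemma sparselyRealizable_iUnion {n : ℕ} {B : Fin n → Set ℕ}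
    (hB : ∀ i, SparselyRealizable (B i)) : SparselyRealizable (⋃ i, B i) := by
  induction n with
  | zero => simpa using sparselyRealizable_empty
  | succ n ih =>
    have : ⋃ i, B i = B 0 ∪ ⋃ i : Fin n, B i.succ := by
      ext x
      simp [Fin.exists_fin_succ]
    rw [this]
    exact (hB 0).union (ih fun i => hB i.succ)

/-- A counter that increases by one and may be reset at multiples of `d` that are at
least `d * a`. -/
def gapRel (d a : ℕ) (i j : Fin (2 * (d * a))) : Prop :=
  j.val = i.val + 1 ∨ (j.val = 0 ∧ d ∣ i.val + 1 ∧ d * a ≤ i.val + 1)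

/-- The label marking the resets of the counter. -/
def gapLabel (d a : ℕ) (i : Fin (2 * (d * a))) : Fin 2 := if i.val = 0 then 1 else 0

lemma gapLabel_eq_one_iff {d a : ℕ} {i : Fin (2 * (d * a))} :
    gapLabel d a i = 1 ↔ i.val = 0 := by
  simp [gapLabel]

lemma dvd_and_le_of_mem_LPSset_gap {d a n : ℕ}
    (hn : n ∈ LPSset (labelShift (gapRel d a) (gapLabel d a))) : d ∣ n ∧ d * a ≤ n := by
  obtain ⟨hn, _, ⟨x, hx, rfl⟩, hp, -⟩ := mem_LPSset_iff.1 hn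
  obtain ⟨i, hi⟩ : ∃ i : ℤ, (x i).val = 0 := by
    by_contra! hne
    have h : ∀ t : ℕ, (x t).val = (x 0).val + t := by
      intro t
      induction t with
      | zero => simp
      | succ t ih =>
        rcases hx t with h | h
        · push_cast
          omega
        · exact absurd h.1 (hne _)
    have := h (2 * (d * a))
    omega
  have hin : (x (i + n)).val = 0 := by
    have := hp i
    simp only at this
    rwa [gapLabel_eq_one_iff.2 hi, gapLabel_eq_one_iff] at this
  constructor
  · have h : ∀ t : ℕ, (x (i + t)).val ≡ t [MOD d] := by
      intro t
      induction t with
      | zero => simp [hi, Nat.ModEq.refl]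
      | succ t ih =>
        have hxt := hx (i + t)
        rw [add_assoc, ← Nat.cast_succ] at hxt
        rcases hxt with h | ⟨h, hd, -⟩
        · rw [h]
          exact ih.add_right 1
        · rw [h]
          exact ((Nat.modEq_zero_iff_dvd.2 hd).symm).trans (ih.add_right 1)
    have := h n
    rw [hin] at this
    exact Nat.modEq_zero_iff_dvd.1 this.symm
  · by_contra! hlt
    have h : ∀ t : ℕ, t < d * a → (x (i + t)).val = t := by
      intro t
      induction t with
      | zero => simp [hi]
      | succ t ih =>
        intro ht
        have hxt := hx (i + t)
        rw [add_assoc, ← Nat.cast_succ] at hxt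
        have := ih (by omega)
        rcases hxt with h | ⟨-, -, hle⟩
        · rw [h, this]
        · omega
    have := h n hlt
    omega

lemma mem_LPSset_gap {d a g k : ℕ} (hda : 0 < d * a) (hd : d ∣ g) (hlt : d * a < g)
    (hle : g ≤ 2 * (d * a)) :
    g + d * a * k ∈ LPSset (labelShift (gapRel d a) (gapLabel d a)) := by
  set c := d * a with hc
  set n := g + c * k with hn
  have hn0 : 0 < n := by omega
  let f : ℕ → Fin (2 * c) := fun j =>
    if h : j < g then ⟨j, by omega⟩ else ⟨(j - g) % c, by have := Nat.mod_lt (j - g) hda; omega⟩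
  have hf₁ : ∀ j, j < g → (f j).val = j := fun j hj => by simp [f, hj]
  have hf₂ : ∀ j, (f (g + j)).val = j % c := fun j => by simp [f]
  have hstep : ∀ j, gapRel d a (f j) (f (j + 1)) := by
    intro j
    rcases lt_trichotomy (j + 1) g with h | h | h
    · left
      rw [hf₁ _ h, hf₁ _ (by omega)]
    · right
      rw [hf₁ j (by omega), h]
      refine ⟨by simpa using hf₂ 0 |>.trans (Nat.zero_mod _), hd, hlt.le⟩
    · obtain ⟨s, rfl⟩ : ∃ s, j = g + s := ⟨j - g, by omega⟩
      rw [gapRel, hf₂, add_assoc, hf₂]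
      have hs := Nat.mod_lt s hda
      have hs' : (s + 1) % c = (s % c + 1) % c := by simp
      rcases Nat.lt_or_ge (s % c + 1) c with h' | h'
      · left
        rw [hs', Nat.mod_eq_of_lt h']
      · right
        have : s % c + 1 = c := by omega
        rw [hs', this]
        exact ⟨Nat.mod_self c, ⟨a, hc⟩, le_rfl⟩
  have hfn : f n = f 0 := by
    apply Fin.ext
    rw [hf₂, hf₁ 0 (by omega)]
    simp
  let x : ℤ → Fin (2 * c) := fun i => f (i % n).toNat
  have hx₀ : ∀ j : ℕ, j ≤ n → x j = f j := by
    intro j hj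
    rcases hj.eq_or_lt with rfl | hj
    · simp [x, hfn]
    · simp only [x]
      rw [Int.emod_eq_of_lt (by omega) (by omega)]
      simp
  have hxn : ∀ i : ℤ, x (i + n) = x i := by
    intro i
    simp [x]
  have hx : ∀ i, gapRel d a (x i) (x (i + 1)) := by
    intro i
    have h0 := Int.emod_nonneg i (b := n) (by omega)
    have h1 := Int.emod_lt_of_pos i (b := n) (by omega)
    obtain ⟨j, hj⟩ : ∃ j : ℕ, i % n = j := ⟨(i % n).toNat, by omega⟩
    have e1 : x i = f j := by simp [x, hj]
    have e2 : x (i + 1) = x (j + 1 : ℕ) := by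
      simp only [x]
      rw [Nat.cast_succ, ← hj]
      simp
    rw [e1, e2, hx₀ _ (by omega)]
    exact hstep j
  refine mem_LPSset_iff.2 ⟨hn0, _, ⟨x, hx, rfl⟩, fun i => by simp only [hxn], ?_⟩
  intro t ht htn h
  have h0 := h 0
  have hc' := h c
  simp only [zero_add] at h0 hc'
  rw [← Nat.cast_zero, hx₀ 0 (by omega), gapLabel_eq_one_iff.2 (hf₁ 0 (by omega)),
    gapLabel_eq_one_iff, hx₀ t (by omega)] at h0
  have htg : g ≤ t := by
    by_contra! htg
    rw [hf₁ t htg] at h0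
    omega
  obtain ⟨s, rfl⟩ := Nat.exists_eq_add_of_le htg
  rw [hf₂] at h0
  obtain ⟨q, rfl⟩ := Nat.dvd_of_mod_eq_zero h0
  have hq : c * (q + 1) ≤ c * k :=
    Nat.mul_le_mul_left c (Nat.lt_of_mul_lt_mul_left (a := c) (by omega))
  rw [mul_add, mul_one] at hq
  have e : (c : ℤ) + ((g + c * q : ℕ) : ℤ) = ((g + c * (q + 1) : ℕ) : ℤ) := by
    push_cast
    ring
  have h1 : gapLabel d a (x ((c : ℤ) + ((g + c * q : ℕ) : ℤ))) = 1 := by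
    rw [e, hx₀ _ (by rw [mul_add]; omega), gapLabel_eq_one_iff, hf₂]
    simp
  rw [hc', gapLabel_eq_one_iff, hx₀ c (by omega), hf₁ c hlt] at h1
  omega

lemma exists_sparselyRealizable_multiples {d : ℕ} (hd : 0 < d) (N : ℕ) :
    ∃ (B : Set ℕ) (M : ℕ), SparselyRealizable B ∧ (∀ n ∈ B, d ∣ n ∧ N ≤ n) ∧
      ∀ n, M ≤ n → d ∣ n → n ∈ B := by
  obtain ⟨a, ha⟩ : ∃ a, a = N + 2 := ⟨_, rfl⟩
  have hda : a ≤ d * a := Nat.le_mul_of_pos_left a hd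
  refine ⟨_, d * a + 1, ⟨Fin (2 * (d * a)), inferInstance, gapRel d a, gapLabel d a, ?_, ?_, ?_,
    rfl⟩, ?_, ?_⟩
  · intro v
    by_cases h : v.val + 1 < 2 * (d * a)
    · exact ⟨⟨v.val + 1, h⟩, Or.inl rfl⟩
    · have : v.val + 1 = 2 * (d * a) := by omega
      refine ⟨⟨0, by omega⟩, Or.inr ⟨rfl, ?_, by omega⟩⟩
      rw [this]
      exact ⟨2 * a, by ring⟩
  · intro w
    by_cases h : w.val = 0
    · refine ⟨⟨2 * (d * a) - 1, by omega⟩, Or.inr ⟨h, ?_, ?_⟩⟩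
      · exact ⟨2 * a, by
          rw [Nat.sub_add_cancel (by omega)]
          ring⟩
      · simp only
        omega
    · exact ⟨⟨w.val - 1, by omega⟩, Or.inl (by simp only; omega)⟩
  · rintro v w hvw ⟨hv, hw⟩
    rw [gapLabel_eq_one_iff] at hv hw
    rcases hvw with h | h
    · omega
    · omega
  · intro n hn
    have := dvd_and_le_of_mem_LPSset_gap hn
    exact ⟨this.1, by omega⟩
  · rintro _ hM ⟨s, rfl⟩
    have hs : a < s := Nat.lt_of_mul_lt_mul_left (a := d) (by omega)
    have h1 := Nat.mod_lt (s - 1) (show 0 < a by omega)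
    have h2 := Nat.mod_add_div (s - 1) a
    obtain ⟨k, hk⟩ : ∃ k, (s - 1) / a = k + 1 :=
      ⟨(s - 1) / a - 1, by have := Nat.div_pos (show a ≤ s - 1 by omega) (by omega); omega⟩
    rw [hk] at h2
    have hs' : s = (a + ((s - 1) % a + 1)) + a * k := by
      rw [mul_add] at h2
      omega
    set r := (s - 1) % a + 1 with hr
    have hdr : d * r ≤ d * a := Nat.mul_le_mul_left d (by omega)
    have hdr' : 0 < d * r := by positivity
    have := mem_LPSset_gap (d := d) (a := a) (g := d * (a + r)) (k := k) (by omega)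
      (Dvd.intro _ rfl) (by rw [mul_add]; omega) (by rw [mul_add]; omega)
    rwa [mul_assoc, ← mul_add, ← hs'] at this

/-- The graph obtained from `R` by recording a phase modulo `D` and adding a cycle of `D` hub
vertices `(q, none)`; one can enter this cycle, and leave it, only when the phase becomes `0`. -/
def hubRel {V : Type*} (D : ℕ) (R : V → V → Prop) (u v : ZMod D × Option V) : Prop :=
  v.1 = u.1 + 1 ∧
    match u.2, v.2 with
    | none, none => True
    | none, some _ => v.1 = 0
    | some _, none => v.1 = 0
    | some a, some b => R a b

/-- Labels for `hubRel`: the hub cycle spells a single occurrence of `11`. -/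
def hubLabel {V : Type*} (D : ℕ) (l : V → Fin 2) (u : ZMod D × Option V) : Fin 2 :=
  match u.2 with
  | none => if u.1 = 1 ∨ u.1 = 2 then 1 else 0
  | some a => l a

section Hub

variable {V : Type*} {D : ℕ} {R : V → V → Prop} {l : V → Fin 2}

lemma hubRel_reflTransGen [NeZero D] (hs : ∀ v, ∃ w, R v w) (hp : ∀ w, ∃ v, R v w)
    (u v : ZMod D × Option V) : Relation.ReflTransGen (hubRel D R) u v := by
  have to_hub : ∀ (t : ℕ) (u : ZMod D × Option V), u.1 + t + 1 = 0 →
      Relation.ReflTransGen (hubRel D R) u (0, none) := by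
    intro t
    induction t with
    | zero =>
      rintro ⟨q, c⟩ hq
      have hq : q + 1 = 0 := by simpa using hq
      refine .single ⟨by simp [hq], ?_⟩
      cases c <;> simp
    | succ t ih =>
      rintro ⟨q, c⟩ hq
      have hq' : (q + 1) + t + 1 = 0 := by
        rw [← hq]
        push_cast
        ring
      rcases c with _ | a
      · exact .head ⟨rfl, trivial⟩ (ih (q + 1, none) hq')
      · obtain ⟨b, hb⟩ := hs a
        exact .head ⟨rfl, hb⟩ (ih (q + 1, some b) hq')
  have hub_hub : ∀ t : ℕ, Relation.ReflTransGen (hubRel D R) (0, none) ((t : ZMod D), none) := by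
    intro t
    induction t with
    | zero => simpa using Relation.ReflTransGen.refl
    | succ t ih => exact ih.tail ⟨by simp, trivial⟩
  have of_hub : ∀ (t : ℕ) (c : Option V),
      Relation.ReflTransGen (hubRel D R) (0, none) ((t : ZMod D), c) := by
    intro t
    induction t with
    | zero =>
      rintro (_ | a)
      · exact hub_hub 0
      · obtain ⟨s, hs⟩ := ZMod.natCast_zmod_surjective (-1 : ZMod D)
        have := hub_hub s
        rw [hs] at this
        exact this.tail ⟨by simp, by simp⟩
    | succ t ih =>
      rintro (_ | a)
      · exact hub_hub _
      · obtain ⟨b, hb⟩ := hp a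
        exact (ih (some b)).tail ⟨by simp, hb⟩
  obtain ⟨t, ht⟩ := ZMod.natCast_zmod_surjective (-1 - u.1)
  obtain ⟨s, hs⟩ := ZMod.natCast_zmod_surjective v.1
  have h2 := of_hub s v.2
  rw [hs] at h2
  exact (to_hub t u (by rw [ht]; ring)).trans h2

lemma natCast_zmod_ne_zero {k : ℕ} (hk : 0 < k) (hkD : k < D) : (k : ZMod D) ≠ 0 := by
  rw [Ne, ZMod.natCast_eq_zero_iff]
  exact fun h => absurd (Nat.le_of_dvd hk h) (by omega)

lemma phase_eq_one_of_hubLabel (hD : 4 ≤ D) (h11 : ∀ v w, R v w → ¬ (l v = 1 ∧ l w = 1))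
    {u v : ZMod D × Option V} (huv : hubRel D R u v) (hu : hubLabel D l u = 1)
    (hv : hubLabel D l v = 1) : u.1 = 1 := by
  have h1 := natCast_zmod_ne_zero (D := D) (k := 1) (by omega) (by omega)
  have h2 := natCast_zmod_ne_zero (D := D) (k := 2) (by omega) (by omega)
  have h3 := natCast_zmod_ne_zero (D := D) (k := 3) (by omega) (by omega)
  push_cast at h1 h2 h3
  obtain ⟨p, c⟩ := u
  obtain ⟨q, e⟩ := v
  obtain ⟨rfl, h⟩ := huv
  rcases c with _ | a <;> rcases e with _ | b <;>
    simp only [hubLabel, ite_eq_left_iff, not_or] at hu hv h ⊢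
  · grind
  · grind
  · grind
  · exact absurd ⟨hu, hv⟩ (h11 _ _ h)

lemma exists_marker_of_hub (hD : 4 ≤ D) {z : ℤ → ZMod D × Option V}
    (hz : ∀ i, hubRel D R (z i) (z (i + 1))) {i : ℤ} (hi : (z i).2 = none) :
    ∃ j, (z j).1 = 1 ∧ hubLabel D l (z j) = 1 ∧ hubLabel D l (z (j + 1)) = 1 := by
  have h1 := natCast_zmod_ne_zero (D := D) (k := 1) (by omega) (by omega)
  have h2 := natCast_zmod_ne_zero (D := D) (k := 2) (by omega) (by omega)
  push_cast at h1 h2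
  have : NeZero D := ⟨by omega⟩
  have forward : ∀ i, (z i).2 = none → (z i).1 + 1 ≠ 0 → (z (i + 1)).2 = none := by
    intro i hi hne
    obtain ⟨hq, h⟩ := hz i
    rw [← hq] at hne
    rw [hi] at h
    rcases hc : (z (i + 1)).2 with _ | b
    · rfl
    · rw [hc] at h
      exact absurd h hne
  have backward : ∀ i, (z (i + 1)).2 = none → (z (i + 1)).1 ≠ 0 → (z i).2 = none := by
    intro i hi hne
    obtain ⟨hq, h⟩ := hz i
    rw [hi] at h
    rcases hc : (z i).2 with _ | b
    · rfl
    · rw [hc] at h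
      exact absurd h hne
  have start : ∀ t : ℕ, t < D → ∀ i, (z i).2 = none → (z i).1 = t →
      ∃ j, (z j).2 = none ∧ (z j).1 = 0 := by
    intro t
    induction t with
    | zero => exact fun _ i hi hq => ⟨i, hi, by simpa using hq⟩
    | succ t ih =>
      intro ht i hi hq
      obtain ⟨k, rfl⟩ : ∃ k, i = k + 1 := ⟨i - 1, by ring⟩
      refine ih (by omega) k (backward k hi ?_) ?_
      · rw [hq]
        exact natCast_zmod_ne_zero (by omega) ht
      · have := (hz k).1
        rw [hq] at this
        push_cast at this
        exact (add_right_cancel this).symm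
  obtain ⟨j, hj, hj0⟩ := start (z i).1.val (ZMod.val_lt _) i hi (by simp)
  have hj1 := forward j hj (by simpa [hj0] using h1)
  have e1 : (z (j + 1)).1 = 1 := by rw [(hz j).1, hj0, zero_add]
  have e2 : (z (j + 1 + 1)).1 = 2 := by rw [(hz (j + 1)).1, e1]; norm_num
  have hj2 := forward (j + 1) hj1 (by rw [e1]; norm_num; exact h2)
  exact ⟨j + 1, e1, by simp [hubLabel, hj1, e1], by simp [hubLabel, hj2, e2]⟩

lemma labelShift_subset_hub : labelShift R l ⊆ labelShift (hubRel D R) (hubLabel D l) := by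
  rintro _ ⟨x, hx, rfl⟩
  exact ⟨fun i => ((i : ZMod D), some (x i)), fun i => ⟨by simp, hx i⟩, rfl⟩

lemma LPSset_hub_subset (hD : 4 ≤ D) (h11 : ∀ v w, R v w → ¬ (l v = 1 ∧ l w = 1)) :
    LPSset (labelShift (hubRel D R) (hubLabel D l)) ⊆ LPSset (labelShift R l) ∪ {n | D ∣ n} := by
  intro n hn
  obtain ⟨hn, _, ⟨z, hz, rfl⟩, hp, hmin⟩ := mem_LPSset_iff.1 hn
  by_cases hhub : ∃ i, (z i).2 = none
  · right
    obtain ⟨i, hi⟩ := hhub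
    obtain ⟨j, hj, hl, hl'⟩ := exists_marker_of_hub (l := l) hD hz hi
    have hphase : ∀ t : ℕ, (z (j + t)).1 = 1 + t := by
      intro t
      induction t with
      | zero => simp [hj]
      | succ t ih =>
        rw [Nat.cast_succ, ← add_assoc, (hz _).1, ih]
        push_cast
        ring
    have p0 := hp j
    have p1 := hp (j + 1)
    simp only at p0 p1
    rw [hl] at p0
    rw [hl', add_right_comm] at p1
    have h1 := phase_eq_one_of_hubLabel hD h11 (hz (j + n)) p0 p1
    rw [hphase n] at h1
    exact (ZMod.natCast_eq_zero_iff n D).1 (by simpa using h1)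
  · left
    push Not at hhub
    choose x hx using fun i => Option.ne_none_iff_exists'.1 (hhub i)
    refine mem_LPSset_iff.2 ⟨hn, fun i => hubLabel D l (z i), ⟨x, fun i => ?_, ?_⟩, hp, hmin⟩
    · have := (hz i).2
      rwa [hx, hx] at this
    · funext i
      simp [hubLabel, hx]

end Hub

lemma SparselyRealizable.exists_irreducible_sofic {S : Set ℕ} (hS : SparselyRealizable S) {D : ℕ}
    (hD : 4 ≤ D) (hDS : ∀ n, 0 < n → D ∣ n → n ∈ S) :
    ∃ Y : Set (ℤ → Fin 2), IsSofic Y ∧ TransitiveOn Y ∧ LPSset Y = S := by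
  obtain ⟨V, _, R, l, hs, hp, h11, rfl⟩ := hS
  have : NeZero D := ⟨by omega⟩
  refine ⟨_, isSofic_labelShift (hubRel D R) (hubLabel D l),
    transitiveOn_labelShift _ _ (hubRel_reflTransGen hs hp), ?_⟩
  refine Set.Subset.antisymm (fun n hn => ?_) (LPSset_mono labelShift_subset_hub)
  rcases LPSset_hub_subset hD h11 hn with h | h
  · exact h
  · exact hDS n hn.1 h

lemma exists_irreducible_sofic_singleton {d : ℕ} (hd : 0 < d) :
    ∃ Y : Set (ℤ → Fin 2), IsSofic Y ∧ TransitiveOn Y ∧ LPSset Y = {d} := by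
  have : NeZero d := ⟨hd.ne'⟩
  refine ⟨_, isSofic_labelShift (fun a b : ZMod d => b = a + 1) (cycleLabel d),
    transitiveOn_labelShift _ _ fun u v => ?_, LPSset_cycle hd⟩
  have h : ∀ t : ℕ, Relation.ReflTransGen (fun a b : ZMod d => b = a + 1) u (u + t) := by
    intro t
    induction t with
    | zero => simpa using Relation.ReflTransGen.refl
    | succ t ih => exact ih.tail (by push_cast; ring)
  obtain ⟨t, ht⟩ := ZMod.natCast_zmod_surjective (v - u)
  simpa [ht] using h t

lemma CofinitePos.exists_forall_ge_mem {T : Set ℕ} (hT : CofinitePos T) :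
    ∃ N, 0 < N ∧ ∀ s, N ≤ s → s ∈ T := by
  obtain ⟨b, hb⟩ := hT.2.bddAbove
  refine ⟨b + 1, by omega, fun s hs => ?_⟩
  by_contra h
  have : s ≤ b := hb ⟨show 0 < s by omega, h⟩
  omega

/-- Every set which is a singleton or of the form `F ∪ ⋃_{i=1}^n dᵢ Sᵢ` with `F` finite,
`n ≥ 1` and each `Sᵢ` cofinite is the least period set of some irreducible sofic shift
over the alphabet `{0, 1}`. -/
theorem realize_LPS_by_irreducible_sofic (S : Set ℕ)
    (hS : (∃ d : ℕ, 0 < d ∧ S = {d}) ∨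
      (∃ (F : Finset ℕ) (n : ℕ) (d : Fin n → ℕ) (T : Fin n → Set ℕ),
        0 < n ∧ (∀ m ∈ F, 0 < m) ∧ (∀ i, 0 < d i) ∧ (∀ i, CofinitePos (T i)) ∧
        S = ↑F ∪ ⋃ i : Fin n, (fun s => d i * s) '' T i)) :
    ∃ Y : Set (ℤ → Fin 2), IsSofic Y ∧ TransitiveOn Y ∧ LPSset Y = S := by
  rcases hS with ⟨d, hd, rfl⟩ | ⟨F, n, d, T, hn, hF, hd, hT, hS⟩
  · exact exists_irreducible_sofic_singleton hd
  choose N hN0 hN using fun i => (hT i).exists_forall_ge_mem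
  have hmem : ∀ i m, d i ∣ m → d i * N i ≤ m → m ∈ S := by
    rintro i _ ⟨s, rfl⟩ hm
    rw [hS]
    exact Or.inr (Set.mem_iUnion.2 ⟨i, s, hN i s (Nat.le_of_mul_le_mul_left hm (hd i)), rfl⟩)
  have hpos : ∀ m ∈ S, 0 < m := by
    intro m hm
    rw [hS] at hm
    rcases hm with hm | hm
    · exact hF m hm
    · obtain ⟨i, s, hs, rfl⟩ := Set.mem_iUnion.1 hm
      exact Nat.mul_pos (hd i) ((hT i).1 hs)
  choose B M hB hBN hBM using fun i => exists_sparselyRealizable_multiples (hd i) (d i * N i)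
  have hBS : ⋃ i, B i ⊆ S :=
    Set.iUnion_subset fun i m hm => hmem i m (hBN i m hm).1 (hBN i m hm).2
  have hfin : (S \ ⋃ i, B i).Finite := by
    refine (F.finite_toSet.union (Set.finite_iUnion fun i => Set.finite_lt_nat (M i))).subset ?_
    rintro m ⟨hm, hmB⟩
    rw [hS] at hm
    rcases hm with hm | hm
    · exact Or.inl hm
    · obtain ⟨i, s, -, rfl⟩ := Set.mem_iUnion.1 hm
      refine Or.inr (Set.mem_iUnion.2 ⟨i, ?_⟩)
      by_contra hlt
      exact hmB (Set.mem_iUnion.2 ⟨i, hBM i _ (not_lt.1 hlt) (Dvd.intro _ rfl)⟩)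
  have hreal : SparselyRealizable S := by
    rw [← Set.sdiff_union_of_subset hBS]
    exact (sparselyRealizable_finite hfin fun m hm => hpos m hm.1).union
      (sparselyRealizable_iUnion hB)
  let i₀ : Fin n := ⟨0, hn⟩
  have h0 : 0 < d i₀ * N i₀ := Nat.mul_pos (hd i₀) (hN0 i₀)
  refine hreal.exists_irreducible_sofic (D := d i₀ * N i₀ * 4) (by omega) fun m hm hdvd =>
    hmem i₀ m ?_ ?_
  · exact (Dvd.intro _ (mul_assoc _ _ _).symm).trans hdvd
  · have := Nat.le_of_dvd hm hdvd
    omega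
end

section
/- For every set S ⊆ ℕ there exists a shift space X ⊆ {0,1}^ℤ (a compact, shift-invariant subset of the full 2-shift) whose least period set satisfies LPS(X) = S. -/
theorem shiftMap_iterate {A : Type*} (n : ℕ) (x : ℤ → A) :
    shiftMap^[n] x = fun i => x (i + n) := by
  induction n generalizing x with
  | zero => simp
  | succ n ih =>
    rw [Function.iterate_succ_apply, ih]
    funext i
    simp only [shiftMap]
    push_cast
    ring_nf

/-- The shift map as a homeomorphism of the full shift. -/
def shiftHomeomorph (A : Type*) [TopologicalSpace A] : (ℤ → A) ≃ₜ (ℤ → A) where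
  toFun := shiftMap
  invFun x i := x (i - 1)
  left_inv x := by funext i; simp [shiftMap]
  right_inv x := by funext i; simp [shiftMap]
  continuous_toFun := by unfold shiftMap; fun_prop
  continuous_invFun := by fun_prop

theorem apply_add_mul_of_periodic {A : Type*} {x : ℤ → A} {p : ℤ} (h : ∀ i, x (i + p) = x i)
    (i k : ℤ) : x (i + k * p) = x i := by
  have h' : Function.Periodic x p := h
  simpa using h'.int_mul k i

/-- Two periodic sequences agreeing on a window as long as the product of their periods agree. -/
theorem eq_of_periodic_of_eqOn {A : Type*} {x y : ℤ → A} {p q : ℤ} (hp : 0 < p) (hq : 0 < q)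
    (hx : ∀ i, x (i + p) = x i) (hy : ∀ i, y (i + q) = y i)
    (h : ∀ i, 0 ≤ i → i < p * q → x i = y i) : x = y := by
  funext i
  have hpq : 0 < p * q := mul_pos hp hq
  have e := h (i % (p * q)) (Int.emod_nonneg _ hpq.ne') (Int.emod_lt_of_pos _ hpq)
  have hi : i = i % (p * q) + i / (p * q) * (p * q) := by
    rw [mul_comm (i / (p * q))]; exact (Int.emod_add_mul_ediv i (p * q)).symm
  rw [hi]
  have e1 := apply_add_mul_of_periodic hx (i % (p * q)) (i / (p * q) * q)
  have e2 := apply_add_mul_of_periodic hy (i % (p * q)) (i / (p * q) * p)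
  rw [show i / (p * q) * (p * q) = i / (p * q) * q * p by ring, e1,
    show i / (p * q) * q * p = i / (p * q) * p * q by ring, e2, e]

/-- A point of the closure of `U` can be matched by a point of `U` on any finite window. -/
theorem exists_eqOn_window_of_mem_closure {A : Type*} [TopologicalSpace A] [DiscreteTopology A]
    {U : Set (ℤ → A)} {y : ℤ → A} (hy : y ∈ closure U) (M : ℤ) :
    ∃ z ∈ U, ∀ i, 0 ≤ i → i < M → z i = y i := by
  obtain ⟨z, hz, hzU⟩ := mem_closure_iff.1 hy ((Set.Ico 0 M).pi fun i => {y i})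
    (isOpen_set_pi (Set.finite_Ico 0 M) fun _ _ => isOpen_discrete _) (fun _ _ => rfl)
  exact ⟨z, hzU, fun i h0 h1 => hz i ⟨h0, h1⟩⟩

/-- The period-doubling sequence, as the set of indices with odd 2-adic valuation. -/
def PeriodDoubling (i : ℕ) : Prop := Odd (padicValNat 2 i)

theorem padicValNat_two_pow_mul_of_odd (k : ℕ) {j : ℕ} (hj : Odd j) :
    padicValNat 2 (2 ^ k * j) = k := by
  have h0 : j ≠ 0 := by rintro rfl; simp at hj
  rw [padicValNat.mul (by positivity) h0, padicValNat.prime_pow,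
    padicValNat.eq_zero_of_not_dvd (by rwa [← even_iff_two_dvd, Nat.not_even_iff_odd]), add_zero]

theorem even_of_periodDoubling {i : ℕ} (h : PeriodDoubling i) : Even i := by
  by_contra hi
  rw [Nat.not_even_iff_odd] at hi
  have := padicValNat_two_pow_mul_of_odd 0 hi
  simp only [pow_zero, one_mul] at this
  simp [PeriodDoubling, this] at h

/-- No factor of length `5 p` of the period-doubling sequence has period `p`. -/
theorem exists_periodDoubling_not_iff_add {p : ℕ} (hp : 0 < p) (b : ℕ) :
    ∃ i, b ≤ i ∧ i < b + 4 * p ∧ ¬ (PeriodDoubling i ↔ PeriodDoubling (i + p)) := by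
  obtain ⟨k, m, hm, rfl⟩ := Nat.exists_eq_two_pow_mul_odd hp.ne'
  have hm0 : 1 ≤ m := hm.pos
  have hk : 0 < 2 ^ k := by positivity
  obtain ⟨c, hc1, hc2⟩ : ∃ c, b ≤ 2 ^ k * c ∧ 2 ^ k * c < b + 2 ^ k := by
    refine ⟨(b + (2 ^ k - 1)) / 2 ^ k, ?_, ?_⟩
    · have := Nat.div_add_mod (b + (2 ^ k - 1)) (2 ^ k)
      have := Nat.mod_lt (b + (2 ^ k - 1)) hk
      omega
    · have := Nat.div_add_mod (b + (2 ^ k - 1)) (2 ^ k)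
      omega
  obtain ⟨j, hj1, hj2, q, hq⟩ : ∃ j, c ≤ j ∧ j ≤ c + 3 ∧ ∃ q, j + m = 2 * (2 * q + 1) := by
    refine ⟨c + (2 + 3 * (c + m)) % 4, by omega, by omega,
      (c + (2 + 3 * (c + m)) % 4 + m) / 4, by omega⟩
  have hj : Odd j := by
    obtain ⟨a, rfl⟩ := hm
    rw [Nat.odd_iff]; omega
  refine ⟨2 ^ k * j, by nlinarith, by nlinarith, ?_⟩
  have e : 2 ^ k * j + 2 ^ k * m = 2 ^ (k + 1) * (2 * q + 1) := by
    rw [← mul_add, hq]; ring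
  rw [e, PeriodDoubling, PeriodDoubling, padicValNat_two_pow_mul_of_odd k hj,
    padicValNat_two_pow_mul_of_odd (k + 1) (by simp), Nat.odd_add_one]
  tauto

open Classical in
/-- The `n`-periodic sequence following the period-doubling sequence on each block of length `n`,
with the two letters around each block boundary set to `1` when `n ≠ 2`. -/
noncomputable def markedPeriodic (n : ℕ) (i : ℤ) : Fin 2 :=
  if (i % n).toNat = 0 ∨ ((i % n).toNat + 1 = n ∧ n ≠ 2) ∨ PeriodDoubling (i % n).toNat then 1
  else 0

theorem markedPeriodic_add_self (n : ℕ) (i : ℤ) :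
    markedPeriodic n (i + n) = markedPeriodic n i := by
  unfold markedPeriodic
  rw [Int.add_emod_right]

theorem markedPeriodic_natCast_eq_one_iff {n r : ℕ} (hr : r < n) :
    markedPeriodic n r = 1 ↔ r = 0 ∨ (r + 1 = n ∧ n ≠ 2) ∨ PeriodDoubling r := by
  have h : ((r : ℤ) % n).toNat = r := by
    rw [← Int.natCast_mod, Int.toNat_natCast, Nat.mod_eq_of_lt hr]
  rw [markedPeriodic, h]
  split_ifs with h1 <;> simp [h1]

theorem not_periodDoubling_one : ¬ PeriodDoubling 1 := fun h => by
  simpa using even_of_periodDoubling h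

/-- `markedPeriodic n` has no positive period smaller than `n`. -/
theorem markedPeriodic_no_smaller_period {n d : ℕ} (hd : 0 < d) (hdn : d < n)
    (h : ∀ i, markedPeriodic n (i + d) = markedPeriodic n i) : False := by
  have h1 := not_periodDoubling_one
  have hzero : markedPeriodic n ((0 : ℕ) : ℤ) = 1 :=
    (markedPeriodic_natCast_eq_one_iff (by omega)).2 (Or.inl rfl)
  have hd1 : markedPeriodic n (d : ℤ) = 1 := by
    rw [← hzero, ← h ((0 : ℕ) : ℤ)]; congr 1; simp
  rw [markedPeriodic_natCast_eq_one_iff hdn] at hd1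
  rcases eq_or_ne n 2 with rfl | hn2
  · obtain rfl : d = 1 := by omega
    simp [h1] at hd1
  have hlast : markedPeriodic n ((d - 1 : ℕ) : ℤ) = 1 := by
    have : markedPeriodic n ((n - 1 : ℕ) : ℤ) = 1 :=
      (markedPeriodic_natCast_eq_one_iff (by omega)).2 (Or.inr (Or.inl ⟨by omega, hn2⟩))
    rw [← this, ← markedPeriodic_add_self n ((d - 1 : ℕ) : ℤ), ← h ((n - 1 : ℕ) : ℤ)]
    congr 1; omega
  rw [markedPeriodic_natCast_eq_one_iff (by omega)] at hlast
  have hone : markedPeriodic n ((1 : ℕ) : ℤ) ≠ 1 := by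
    rw [Ne, markedPeriodic_natCast_eq_one_iff (by omega)]
    rintro (h | h | h)
    · omega
    · omega
    · exact h1 h
  rcases eq_or_ne (d + 1) n with hdn' | hdn'
  · refine hone ?_
    rw [← h ((1 : ℕ) : ℤ), ← hzero, ← markedPeriodic_add_self n ((0 : ℕ) : ℤ)]
    congr 1; omega
  · have e1 : PeriodDoubling d := by
      rcases hd1 with h | h | h
      · omega
      · omega
      · exact h
    rcases hlast with h2 | h2 | h2
    · obtain rfl : d = 1 := by omega
      exact h1 e1
    · omega
    · have := even_of_periodDoubling e1
      have := even_of_periodDoubling h2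
      simp only [Nat.even_iff] at *
      omega

/-- For long blocks, no long window of `markedPeriodic n` has period `p`. -/
theorem lt_of_markedPeriodic_window {n p : ℕ} (hp : 0 < p) (a : ℤ)
    (h : ∀ i : ℤ, 0 ≤ i → i < 10 * p + 4 →
      markedPeriodic n (i + p + a) = markedPeriodic n (i + a)) :
    n < 10 * p + 4 := by
  by_contra! hn
  have hn0 : (0 : ℤ) < n := by omega
  obtain ⟨s, b, o, ho, hb1, hb2, hab⟩ : ∃ s : ℤ, ∃ b o : ℕ, o ≤ 5 * p + 4 ∧ 1 ≤ b ∧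
      b + 5 * p + 1 ≤ n ∧ a + o = b + s * n := by
    have h1 := Int.emod_nonneg a hn0.ne'
    have h2 := Int.emod_lt_of_pos a hn0
    have h3 := Int.emod_add_mul_ediv a n
    rw [mul_comm] at h3
    by_cases hr : a % n + 5 * p + 2 ≤ n
    · exact ⟨a / n, (a % n).toNat + 1, 1, by omega, by omega, by omega, by omega⟩
    · refine ⟨a / n + 1, 1, (n + 1 - a % n).toNat, by omega, by omega, by omega, ?_⟩
      rw [add_mul]; omega
  obtain ⟨i, hi1, hi2, hi⟩ := exists_periodDoubling_not_iff_add hp b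
  have key := h (i - b + o) (by omega) (by omega)
  have hper := apply_add_mul_of_periodic (markedPeriodic_add_self n)
  rw [show (i - b + o + p + a : ℤ) = ((i + p : ℕ) : ℤ) + s * n by push_cast; linarith,
    show (i - b + o + a : ℤ) = (i : ℤ) + s * n by linarith, hper, hper] at key
  have key' : markedPeriodic n ((i + p : ℕ) : ℤ) = 1 ↔ markedPeriodic n (i : ℤ) = 1 := by rw [key]
  rw [markedPeriodic_natCast_eq_one_iff (by omega),
    markedPeriodic_natCast_eq_one_iff (by omega)] at key'
  apply hi
  have e1 : i ≠ 0 := by omega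
  have e2 : i + 1 ≠ n := by omega
  have e3 : i + p ≠ 0 := by omega
  have e4 : i + p + 1 ≠ n := by omega
  simp only [e1, e2, e3, e4, false_and, false_or] at key'
  exact key'.symm

/-- The translates of the sequences `markedPeriodic n` for `n ∈ S`. -/
def markedOrbits (S : Set ℕ) : Set (ℤ → Fin 2) :=
  {z | ∃ n ∈ S, ∃ a : ℤ, z = fun i => markedPeriodic n (i + a)}

theorem shiftMap_image_markedOrbits (S : Set ℕ) :
    shiftMap '' markedOrbits S = markedOrbits S := by
  ext z
  constructor
  · rintro ⟨_, ⟨n, hn, a, rfl⟩, rfl⟩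
    exact ⟨n, hn, 1 + a, by funext i; simp only [shiftMap, add_assoc]⟩
  · rintro ⟨n, hn, a, rfl⟩
    exact ⟨_, ⟨n, hn, a - 1, rfl⟩, by funext i; simp only [shiftMap]; congr 1; ring⟩

/-- A periodic point in the closure of the orbits already lies in one of the orbits. -/
theorem mem_markedOrbits_of_periodic {S : Set ℕ} (hS : ∀ m ∈ S, 0 < m) {y : ℤ → Fin 2}
    (hy : y ∈ closure (markedOrbits S)) {p : ℕ} (hp : 0 < p) (hper : ∀ i, y (i + p) = y i) :
    y ∈ markedOrbits S := by
  obtain ⟨z, hz, hzy⟩ := exists_eqOn_window_of_mem_closure hy ((10 * p + 4) * p + (11 * p + 4))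
  obtain ⟨n, hn, a, rfl⟩ := id hz
  have hn0 := hS n hn
  have hp' : (0 : ℤ) < p := by exact_mod_cast hp
  have hlt : n < 10 * p + 4 := by
    refine lt_of_markedPeriodic_window hp a fun i h0 h1 => ?_
    have e1 := hzy (i + p) (by omega) (by nlinarith)
    have e2 := hzy i h0 (by nlinarith)
    simp only at e1 e2
    rw [e1, e2, hper]
  have hnz : (n : ℤ) < 10 * p + 4 := by exact_mod_cast hlt
  have : (fun i => markedPeriodic n (i + a)) = y := by
    refine eq_of_periodic_of_eqOn (p := n) (q := p) (by exact_mod_cast hn0) hp' (fun i => ?_) hper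
      fun i h0 h1 => hzy i h0 (by nlinarith)
    rw [add_right_comm, markedPeriodic_add_self]
  rwa [← this]

/-- Every subset of `ℕ = {1, 2, ...}` is the least period set of some shift space
(compact, shift-invariant subset) inside the full 2-shift. -/
theorem realize_arbitrary_LPS (S : Set ℕ) (hS : ∀ m ∈ S, 0 < m) :
    ∃ X : Set (ℤ → Fin 2), IsCompact X ∧ shiftMap '' X = X ∧ LPSset X = S := by
  refine ⟨closure (markedOrbits S), isClosed_closure.isCompact, ?_, ?_⟩
  · have h := (shiftHomeomorph (Fin 2)).image_closure (markedOrbits S)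
    change shiftMap '' _ = closure (shiftMap '' _) at h
    rw [h, shiftMap_image_markedOrbits]
  have hlower : ∀ n d : ℕ, ∀ a : ℤ, 0 < d → d < n →
      shiftMap^[d] (fun i => markedPeriodic n (i + a)) ≠ fun i => markedPeriodic n (i + a) := by
    intro n d a hd hdn h
    rw [shiftMap_iterate] at h
    refine markedPeriodic_no_smaller_period hd hdn fun i => ?_
    have := congrFun h (i - a)
    rwa [sub_add_cancel, show i - a + d + a = i + d by ring] at this
  have hself : ∀ n : ℕ, ∀ a : ℤ,
      shiftMap^[n] (fun i => markedPeriodic n (i + a)) = fun i => markedPeriodic n (i + a) := by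
    intro n a
    rw [shiftMap_iterate]
    funext i
    rw [add_right_comm, markedPeriodic_add_self]
  ext p
  constructor
  · rintro ⟨hp, y, hy, hper, hmin⟩
    obtain ⟨n, hn, a, rfl⟩ := mem_markedOrbits_of_periodic hS hy hp fun i => by
      have := congrFun hper i
      rwa [shiftMap_iterate] at this
    rcases lt_trichotomy p n with h | rfl | h
    · exact absurd hper (hlower n p a hp h)
    · exact hn
    · exact absurd (hself n a) (hmin n (hS n hn) h)
  · intro hp
    exact ⟨hS p hp, fun i => markedPeriodic p (i + 0), subset_closure ⟨p, hp, 0, rfl⟩,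
      hself p 0, fun k hk hkp => hlower p k 0 hk hkp⟩
end
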